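/- arXiv:2602.01650 — 3 statements merged into one kernel-verified Lean document; each statement's English description precedes it below -/
import Mathlib

section
/- The K-algebra homomorphism φ : A(m,n) → L(m,n) determined entrywise by e^{p,k,l} ↦ x_{•1} ⋆ ⋯ ⋆ x_{•1} ⋆ x_{•k} ⋆ y_{l•} ⋆ y_{1•} ⋆ ⋯ ⋆ y_{1•} (with p−1 factors x_{•1} on the left and p−1 factors y_{1•} on the right) is well defined and injective, and its image is L(m,n)_0^{xy}. In particular A(m,n) ≅ L(m,n)_0^{xy} as K-algebras. -/
open scoped BigOperators

/-- Generators of the Leavitt algebra `L(m,n)`: `Sum.inl (i,j)` is the x-letter `x_{ij}`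
(`1 ≤ i ≤ m`, `1 ≤ j ≤ n`, written 0-indexed), and `Sum.inr (j,i)` is the y-letter `y_{ji}`. -/
abbrev LGen (m n : ℕ) := (Fin m × Fin n) ⊕ (Fin n × Fin m)

/-- The defining relations of the Leavitt algebra `L(m,n)`:
`∑_j x_{ij} y_{ji'} = δ_{i,i'}` and `∑_i y_{ji} x_{ij'} = δ_{j,j'}`. -/
inductive LRel (K : Type) [Field K] (m n : ℕ) :
    FreeAlgebra K (LGen m n) → FreeAlgebra K (LGen m n) → Prop
  | xy (i i' : Fin m) :
      LRel K m n
        (∑ j : Fin n, FreeAlgebra.ι K (Sum.inl (i, j)) * FreeAlgebra.ι K (Sum.inr (j, i')))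
        (if i = i' then 1 else 0)
  | yx (j j' : Fin n) :
      LRel K m n
        (∑ i : Fin m, FreeAlgebra.ι K (Sum.inr (j, i)) * FreeAlgebra.ι K (Sum.inl (i, j')))
        (if j = j' then 1 else 0)

/-- The Leavitt algebra `L(m,n)`, presented by the generators `x_{ij}, y_{ji}` and the
relations `∑_j x_{ij} y_{ji'} = δ_{i,i'}`, `∑_i y_{ji} x_{ij'} = δ_{j,j'}`. -/
abbrev Leavitt (K : Type) [Field K] (m n : ℕ) := RingQuot (LRel K m n)

/-- The image of a generator in `L(m,n)`. -/
noncomputable def lgen (K : Type) [Field K] {m n : ℕ} (z : LGen m n) : Leavitt K m n :=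
  RingQuot.mkAlgHom K (LRel K m n) (FreeAlgebra.ι K z)

/-- The generator `x_{ij}` of `L(m,n)` (0-indexed). -/
noncomputable def xg (K : Type) [Field K] {m n : ℕ} (i : Fin m) (j : Fin n) : Leavitt K m n :=
  lgen K (Sum.inl (i, j))

/-- The generator `y_{ji}` of `L(m,n)` (0-indexed). -/
noncomputable def yg (K : Type) [Field K] {m n : ℕ} (j : Fin n) (i : Fin m) : Leavitt K m n :=
  lgen K (Sum.inr (j, i))

/-- A word over the generating set `X` of `L(m,n)`. -/
abbrev LWord (m n : ℕ) := List (LGen m n)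

/-- The image of a word in `L(m,n)` (product of the images of its letters). -/
noncomputable def wordToL (K : Type) [Field K] {m n : ℕ} (w : LWord m n) : Leavitt K m n :=
  (w.map (lgen K)).prod

/-- A word is balanced if it has equally many x-letters and y-letters. -/
def LWord.Balanced {m n : ℕ} (w : LWord m n) : Prop :=
  w.countP Sum.isLeft = w.countP Sum.isRight

/-- The degree of a word: number of x-letters minus number of y-letters. -/
def LWord.degree {m n : ℕ} (w : LWord m n) : ℤ :=
  (w.countP Sum.isLeft : ℤ) - (w.countP Sum.isRight : ℤ)

/-- The `k`-component of the canonical grading of `L(m,n)`: the `K`-linear span of the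
images of all words of degree `k`. -/
noncomputable def Lcomponent (K : Type) [Field K] (m n : ℕ) (k : ℤ) :
    Submodule K (Leavitt K m n) :=
  Submodule.span K {a | ∃ w : LWord m n, w.degree = k ∧ wordToL K w = a}

/-- A pair of consecutive letters is forbidden if it is of the form `x_{in} y_{ni'}` or
`y_{jm} x_{mj'}` (the second index of the first letter being maximal). -/
def LForbidden {m n : ℕ} (z z' : LGen m n) : Prop :=
  (∃ (i i' : Fin m) (j : Fin n), (j : ℕ) = n - 1 ∧ z = Sum.inl (i, j) ∧ z' = Sum.inr (j, i')) ∨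
  (∃ (j j' : Fin n) (i : Fin m), (i : ℕ) = m - 1 ∧ z = Sum.inr (j, i) ∧ z' = Sum.inl (i, j'))

/-- A word is irreducible if it contains no forbidden subword `x_{in} y_{ni'}` or
`y_{jm} x_{mj'}`. -/
def LWord.Irr {m n : ℕ} (w : LWord m n) : Prop :=
  ∀ (u v : LWord m n) (z z' : LGen m n), w = u ++ z :: z' :: v → ¬ LForbidden z z'

/-- A nonempty balanced word is prime if it is not the concatenation of two nonempty
balanced words. -/
def LWord.IsPrime {m n : ℕ} (w : LWord m n) : Prop :=
  w ≠ [] ∧ w.Balanced ∧ ∀ u v : LWord m n, w = u ++ v → u ≠ [] → v ≠ [] → ¬ u.Balanced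

/-- An xy word: a nonempty balanced word whose first letter is an x-letter and whose
last letter is a y-letter. -/
def LWord.XY {m n : ℕ} (w : LWord m n) : Prop :=
  w.Balanced ∧ (∃ p, w.head? = some (Sum.inl p)) ∧ (∃ q, w.getLast? = some (Sum.inr q))

/-- A yx word: a nonempty balanced word whose first letter is a y-letter and whose
last letter is an x-letter. -/
def LWord.YX {m n : ℕ} (w : LWord m n) : Prop :=
  w.Balanced ∧ (∃ q, w.head? = some (Sum.inr q)) ∧ (∃ p, w.getLast? = some (Sum.inl p))

/-- Membership in the submonoid `⟨X⟩₀^{xy}` of `⟨X⟩₀` generated by the prime xy words. -/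
def LWord.InXY {m n : ℕ} (w : LWord m n) : Prop :=
  ∃ ws : List (LWord m n), (∀ u ∈ ws, u.IsPrime ∧ u.XY) ∧ ws.flatten = w

/-- Membership in the submonoid `⟨X⟩₀^{yx}` of `⟨X⟩₀` generated by the prime yx words. -/
def LWord.InYX {m n : ℕ} (w : LWord m n) : Prop :=
  ∃ ws : List (LWord m n), (∀ u ∈ ws, u.IsPrime ∧ u.YX) ∧ ws.flatten = w

/-- The subalgebra `L(m,n)₀^{xy}` of `L(m,n)` generated by images of all prime xy words. -/
noncomputable def L0xy (K : Type) [Field K] (m n : ℕ) : Subalgebra K (Leavitt K m n) :=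
  Algebra.adjoin K {a | ∃ w : LWord m n, w.IsPrime ∧ w.XY ∧ wordToL K w = a}

/-- The subalgebra `L(m,n)₀^{yx}` of `L(m,n)` generated by images of all prime yx words. -/
noncomputable def L0yx (K : Type) [Field K] (m n : ℕ) : Subalgebra K (Leavitt K m n) :=
  Algebra.adjoin K {a | ∃ w : LWord m n, w.IsPrime ∧ w.YX ∧ wordToL K w = a}

/-- The zero component `L(m,n)₀`, as a subalgebra: it is generated (indeed spanned)
by the images of all balanced words. -/
noncomputable def L0 (K : Type) [Field K] (m n : ℕ) : Subalgebra K (Leavitt K m n) :=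
  Algebra.adjoin K {a | ∃ w : LWord m n, w.Balanced ∧ wordToL K w = a}

/-- The block-diagonal matrix `⊕^t A` (with `t` copies of `A ∈ M_{a×b}` on the diagonal and
zeros elsewhere), written as a matrix with `e = t*a` rows and `f = t*b` columns: the entry at
(0-indexed) position `(i,j)` is `A (i % a) (j % b)` if `i / a = j / b`, and `0` otherwise. -/
def blockOplus {R : Type} [Semiring R] {a b : ℕ} (ha : 0 < a) (hb : 0 < b) (e f : ℕ)
    (A : Matrix (Fin a) (Fin b) R) : Matrix (Fin e) (Fin f) R :=
  Matrix.of fun i j =>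
    if (i : ℕ) / a = (j : ℕ) / b then
      A ⟨(i : ℕ) % a, Nat.mod_lt _ ha⟩ ⟨(j : ℕ) % b, Nat.mod_lt _ hb⟩
    else 0

/-- Generators of the algebra `A(m,n)`: `⟨p, k, l, i, j⟩` stands for the generator
`e^{p+1,k,l}_{ij}` (everything 0-indexed, so the stored `p : ℕ` represents the paper's
`p ≥ 1` shifted by one; `k, l ∈ Fin n`; `i, j ∈ Fin (m^(p+1))`). -/
abbrev AGen (m n : ℕ) := Σ p : ℕ, Fin n × Fin n × Fin (m ^ (p + 1)) × Fin (m ^ (p + 1))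

/-- The matrix `e^{p+1,k,l}` of generators, as a matrix over the free algebra. -/
noncomputable def EmF (K : Type) [Field K] (m n : ℕ) (p : ℕ) (k l : Fin n) :
    Matrix (Fin (m ^ (p + 1))) (Fin (m ^ (p + 1))) (FreeAlgebra K (AGen m n)) :=
  Matrix.of fun i j => FreeAlgebra.ι K (⟨p, k, l, i, j⟩ : AGen m n)

/-- The defining relations of `A(m,n)` (entrywise):
(i) `e^{p,k,l} e^{p,k',l'} = δ_{l,k'} e^{p,k,l'}` and
(ii) `∑_k e^{p,k,k} = ⊕^m e^{p−1,1,1}` (with `e^{0,1,1} = (1)`). -/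
inductive ARel (K : Type) [Field K] (m n : ℕ) (hm : 0 < m) (hn : 0 < n) :
    FreeAlgebra K (AGen m n) → FreeAlgebra K (AGen m n) → Prop
  | mul (p : ℕ) (k l k' l' : Fin n) (i j : Fin (m ^ (p + 1))) :
      ARel K m n hm hn ((EmF K m n p k l * EmF K m n p k' l') i j)
        (if l = k' then EmF K m n p k l' i j else 0)
  | sum0 (i j : Fin (m ^ (0 + 1))) :
      ARel K m n hm hn (∑ kk : Fin n, EmF K m n 0 kk kk i j) (if i = j then 1 else 0)
  | sumS (p : ℕ) (i j : Fin (m ^ (p + 1 + 1))) :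
      ARel K m n hm hn (∑ kk : Fin n, EmF K m n (p + 1) kk kk i j)
        (if (i : ℕ) / m ^ (p + 1) = (j : ℕ) / m ^ (p + 1) then
          EmF K m n p ⟨0, hn⟩ ⟨0, hn⟩
            ⟨(i : ℕ) % m ^ (p + 1), Nat.mod_lt _ (pow_pos hm _)⟩
            ⟨(j : ℕ) % m ^ (p + 1), Nat.mod_lt _ (pow_pos hm _)⟩
        else 0)

/-- The algebra `A(m,n)`. -/
abbrev AAlg (K : Type) [Field K] (m n : ℕ) (hm : 0 < m) (hn : 0 < n) :=
  RingQuot (ARel K m n hm hn)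

/-- The image of a generator in `A(m,n)`. -/
noncomputable def mkA (K : Type) [Field K] {m n : ℕ} (hm : 0 < m) (hn : 0 < n)
    (g : AGen m n) : AAlg K m n hm hn :=
  RingQuot.mkAlgHom K (ARel K m n hm hn) (FreeAlgebra.ι K g)

/-- The matrix `e^{p+1,k,l}` over `A(m,n)`. -/
noncomputable def eA (K : Type) [Field K] {m n : ℕ} (hm : 0 < m) (hn : 0 < n)
    (p : ℕ) (k l : Fin n) :
    Matrix (Fin (m ^ (p + 1))) (Fin (m ^ (p + 1))) (AAlg K m n hm hn) :=
  (EmF K m n p k l).map (RingQuot.mkAlgHom K (ARel K m n hm hn))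

/-- The matrix `x_{•1}^{⋆(p)} ⋆ x_{•k} ⋆ y_{l•} ⋆ y_{1•}^{⋆(p)}` over `L(m,n)` (with `p`
factors `x_{•1}` on the left and `p` factors `y_{1•}` on the right, and where the index `1`
is written `⟨0, hn⟩`), computed via the definition of `⋆`: for a column `u ∈ M_{m×1}` and
`W ∈ M_{m^q × m^q}`, `u ⋆ W = (⊕^{m^q} u) · W`, and for a row `v ∈ M_{1×m}`,
`W' ⋆ v = W' · (⊕^{m^q} v)`. -/
noncomputable def starXY (K : Type) [Field K] {m n : ℕ} (hm : 0 < m) (hn : 0 < n)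
    (k l : Fin n) : (p : ℕ) → Matrix (Fin (m ^ (p + 1))) (Fin (m ^ (p + 1))) (Leavitt K m n)
  | 0 => Matrix.of fun i j =>
      xg K (Fin.cast (pow_one m) i) k * yg K l (Fin.cast (pow_one m) j)
  | p + 1 =>
      blockOplus hm one_pos (m ^ (p + 2)) (m ^ (p + 1))
          (Matrix.of fun (i : Fin m) (_ : Fin 1) => xg K i ⟨0, hn⟩) *
        starXY K hm hn k l p *
        blockOplus one_pos hm (m ^ (p + 1)) (m ^ (p + 2))
          (Matrix.of fun (_ : Fin 1) (j : Fin m) => yg K ⟨0, hn⟩ j)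

section Leavitt

variable {K : Type} [Field K] {m n : ℕ}

theorem sum_xg_mul_yg (i i' : Fin m) :
    ∑ j : Fin n, xg K i j * yg K j i' = if i = i' then 1 else 0 := by
  have h := RingQuot.mkAlgHom_rel K (LRel.xy (K := K) (n := n) i i')
  rw [map_sum] at h
  simp only [map_mul] at h
  rw [apply_ite (RingQuot.mkAlgHom K (LRel K m n)), map_one, map_zero] at h
  exact h

theorem sum_yg_mul_xg (j j' : Fin n) :
    ∑ i : Fin m, yg K j i * xg K i j' = if j = j' then 1 else 0 := by
  have h := RingQuot.mkAlgHom_rel K (LRel.yx (K := K) (m := m) j j')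
  rw [map_sum] at h
  simp only [map_mul] at h
  rw [apply_ite (RingQuot.mkAlgHom K (LRel K m n)), map_one, map_zero] at h
  exact h

/-- A linear isomorphism `V^m ≃ V^n` makes `V` a module over `L(m,n)`. -/
theorem exists_leavitt_rep {V : Type} [AddCommGroup V] [Module K V]
    (Φ : (Fin m → V) ≃ₗ[K] (Fin n → V)) :
    ∃ ρ : Leavitt K m n →ₐ[K] Module.End K V,
      (∀ j i v, ρ (yg K j i) v = Φ (Pi.single i v) j) ∧
      (∀ i j v, ρ (xg K i j) v = Φ.symm (Pi.single j v) i) := by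
  let X : Fin m → Fin n → Module.End K V := fun i j =>
    LinearMap.proj i ∘ₗ Φ.symm.toLinearMap ∘ₗ LinearMap.single K (fun _ => V) j
  let Y : Fin n → Fin m → Module.End K V := fun j i =>
    LinearMap.proj j ∘ₗ Φ.toLinearMap ∘ₗ LinearMap.single K (fun _ => V) i
  have hX : ∀ i j v, X i j v = Φ.symm (Pi.single j v) i := fun _ _ _ => rfl
  have hY : ∀ j i v, Y j i v = Φ (Pi.single i v) j := fun _ _ _ => rfl
  let g : LGen m n → Module.End K V := Sum.elim (fun q => X q.1 q.2) (fun q => Y q.1 q.2)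
  have hrel : ∀ ⦃a b⦄, LRel K m n a b → FreeAlgebra.lift K g a = FreeAlgebra.lift K g b := by
    intro a b h
    cases h with
    | xy i i' =>
      ext v
      have key : ∑ j, Φ.symm (Pi.single j (Φ (Pi.single i' v) j)) i
          = Pi.single (M := fun _ => V) i' v i := by
        rw [← Finset.sum_apply, ← map_sum, Finset.univ_sum_single, Φ.symm_apply_apply]
      simp only [map_sum, map_mul, FreeAlgebra.lift_ι_apply, g, Sum.elim_inl, Sum.elim_inr,
        LinearMap.sum_apply, Module.End.mul_apply, hX, hY, key]
      by_cases h : i = i'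
      · subst h; simp
      · simp [h]
    | yx j j' =>
      ext v
      have key : ∑ i, Φ (Pi.single i (Φ.symm (Pi.single j' v) i)) j
          = Pi.single (M := fun _ => V) j' v j := by
        rw [← Finset.sum_apply, ← map_sum, Finset.univ_sum_single, Φ.apply_symm_apply]
      simp only [map_sum, map_mul, FreeAlgebra.lift_ι_apply, g, Sum.elim_inl, Sum.elim_inr,
        LinearMap.sum_apply, Module.End.mul_apply, hX, hY, key]
      by_cases h : j = j'
      · subst h; simp
      · simp [h]
  refine ⟨RingQuot.liftAlgHom K ⟨FreeAlgebra.lift K g, hrel⟩, fun j i v => ?_, fun i j v => ?_⟩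
  · rw [yg, lgen, RingQuot.liftAlgHom_mkAlgHom_apply, FreeAlgebra.lift_ι_apply]
    exact hY j i v
  · rw [xg, lgen, RingQuot.liftAlgHom_mkAlgHom_apply, FreeAlgebra.lift_ι_apply]
    exact hX i j v

/-- A sequence of modules `N 0, N 1, …` with isomorphisms `(N p)^m ≃ (N (p+1))^n` embeds into a
module over `L(m,n)`, with `x`-letters lowering and `y`-letters raising the index. -/
theorem exists_leavitt_rep_of_tower (hm : 0 < m) (hn : 0 < n) (N : ℕ → Type)
    [∀ p, AddCommGroup (N p)] [∀ p, Module K (N p)]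
    (Φ : ∀ p, (Fin m → N p) ≃ₗ[K] (Fin n → N (p + 1))) :
    ∃ (V : Type) (_ : AddCommGroup V) (_ : Module K V) (ρ : Leavitt K m n →ₐ[K] Module.End K V)
      (ι : ∀ p, N p →ₗ[K] V), (∀ p, Function.Injective (ι p)) ∧
      (∀ p j i v, ρ (yg K j i) (ι p v) = ι (p + 1) (Φ p (Pi.single i v) j)) ∧
      (∀ p i j v, ρ (xg K i j) (ι (p + 1) v) = ι p ((Φ p).symm (Pi.single j v) i)) := by
  have : Nonempty (Fin m) := ⟨⟨0, hm⟩⟩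
  have : Nonempty (Fin n) := ⟨⟨0, hn⟩⟩
  obtain ⟨σ⟩ : Nonempty (Fin m × ℕ ≃ (Fin n × ℕ) ⊕ Fin n) := nonempty_equiv_of_countable
  let Ψ : (Fin m → (ℕ → N 0) × ∀ p, N p) ≃ₗ[K] (Fin n → (ℕ → N 0) × ∀ p, N p) :=
    { toFun := fun f j =>
        (fun t => (f (σ.symm (Sum.inl (j, t))).1).1 (σ.symm (Sum.inl (j, t))).2,
          fun p => match p with
            | 0 => (f (σ.symm (Sum.inr j)).1).1 (σ.symm (Sum.inr j)).2
            | p + 1 => Φ p (fun i => (f i).2 p) j)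
      invFun := fun g i =>
        (fun t => Sum.elim (fun q => (g q.1).1 q.2) (fun j => (g j).2 0) (σ (i, t)),
          fun p => (Φ p).symm (fun j => (g j).2 (p + 1)) i)
      map_add' := by
        intro f g
        ext j
        · rfl
        · rename_i p
          cases p with
          | zero => rfl
          | succ p => exact congrFun ((Φ p).map_add (fun i => (f i).2 p) (fun i => (g i).2 p)) j
      map_smul' := by
        intro c f
        ext j
        · rfl
        · rename_i p
          cases p with
          | zero => rfl
          | succ p => exact congrFun ((Φ p).map_smul c (fun i => (f i).2 p)) j
      left_inv := by
        intro f
        ext i t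
        · obtain ⟨q, hq⟩ : ∃ q, σ (i, t) = q := ⟨_, rfl⟩
          have hq' : (i, t) = σ.symm q := by rw [← hq, σ.symm_apply_apply]
          rcases q with ⟨j, t'⟩ | j <;> simp [hq, ← hq']
        · exact congrFun ((Φ t).symm_apply_apply (fun i => (f i).2 t)) i
      right_inv := by
        intro g
        ext j t
        · simp
        · cases t with
          | zero => simp
          | succ p => exact congrFun ((Φ p).apply_symm_apply (fun j => (g j).2 (p + 1))) j }
  obtain ⟨ρ, hy, hx⟩ := exists_leavitt_rep Ψ
  have fst_single : ∀ {k : ℕ} (a b : Fin k) (p : ℕ) (v : N p),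
      ((Pi.single a (0, Pi.single p v) : Fin k → (ℕ → N 0) × ∀ p, N p) b).1 = 0 := by
    intro k a b p v
    by_cases h : b = a
    · subst h; simp
    · simp [h]
  have snd_single : ∀ {k : ℕ} (a : Fin k) (p : ℕ) (v : N p),
      (fun b => ((Pi.single a (0, Pi.single p v) : Fin k → (ℕ → N 0) × ∀ p, N p) b).2 p)
        = Pi.single a v := by
    intro k a p v
    ext b
    by_cases h : b = a
    · subst h; simp
    · simp [h]
  have snd_single_ne : ∀ {k : ℕ} (a : Fin k) (p q : ℕ) (v : N p), q ≠ p →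
      (fun b => ((Pi.single a (0, Pi.single p v) : Fin k → (ℕ → N 0) × ∀ p, N p) b).2 q)
        = 0 := by
    intro k a p q v hq
    ext b
    by_cases h : b = a
    · subst h; simp [hq]
    · simp [h]
  refine ⟨_, _, _, ρ, fun p => LinearMap.inr K _ _ ∘ₗ LinearMap.single K N p, fun p v w h => ?_,
    fun p j i v => ?_, fun p i j v => ?_⟩
  · rw [LinearMap.comp_apply, LinearMap.comp_apply] at h
    exact Pi.single_injective p (Prod.ext_iff.1 h).2
  · rw [LinearMap.comp_apply, hy]
    ext t
    · exact congrFun (fst_single _ _ p v) _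
    · cases t with
      | zero => exact congrFun (fst_single _ _ p v) _
      | succ q =>
        refine Eq.trans (b := Φ q (fun b => ((Pi.single i (0, Pi.single p v) :
          Fin m → (ℕ → N 0) × ∀ p, N p) b).2 q) j) rfl ?_
        change _ = Pi.single (p + 1) (Φ p (Pi.single i v) j) (q + 1)
        by_cases h : q = p
        · subst h
          rw [snd_single, Pi.single_eq_same]
        · rw [snd_single_ne _ _ _ _ h, Pi.single_eq_of_ne (by simpa using h), map_zero,
            Pi.zero_apply]
  · rw [LinearMap.comp_apply, hx]
    ext t
    · change Sum.elim (fun q => _) (fun j' => _) (σ (i, t)) = 0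
      rcases σ (i, t) with ⟨j', t'⟩ | j'
      · exact congrFun (fst_single _ _ (p + 1) v) _
      · exact congrFun (snd_single_ne j (p + 1) 0 v (Nat.succ_ne_zero p).symm) j'
    · refine Eq.trans (b := (Φ t).symm (fun b => ((Pi.single j (0, Pi.single (p + 1) v) :
          Fin n → (ℕ → N 0) × ∀ p, N p) b).2 (t + 1)) i) rfl ?_
      change _ = Pi.single p ((Φ p).symm (Pi.single j v) i) t
      by_cases h : t = p
      · subst h
        rw [snd_single, Pi.single_eq_same]
      · rw [snd_single_ne _ _ _ _ (by simpa using h), Pi.single_eq_of_ne h, map_zero,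
          Pi.zero_apply]

end Leavitt

section Digits

/-- Base-`m` numerals with `p + 1` digits, split as (leading digit, remaining digits). -/
def topDigit (m p : ℕ) : Fin (m ^ (p + 1)) ≃ Fin m × Fin (m ^ p) :=
  (finCongr (pow_succ' m p)).trans finProdFinEquiv.symm

variable {m : ℕ}

theorem topDigit_fst_val {p : ℕ} (i : Fin (m ^ (p + 1))) :
    ((topDigit m p i).1 : ℕ) = (i : ℕ) / m ^ p := rfl

theorem topDigit_snd_val {p : ℕ} (i : Fin (m ^ (p + 1))) :
    ((topDigit m p i).2 : ℕ) = (i : ℕ) % m ^ p := rfl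

theorem sum_topDigit {M : Type} [AddCommMonoid M] {p : ℕ} (f : Fin (m ^ (p + 1)) → M) :
    ∑ i, f i = ∑ a : Fin m, ∑ s : Fin (m ^ p), f ((topDigit m p).symm (a, s)) := by
  rw [← Fintype.sum_prod_type', (topDigit m p).symm.sum_comp]

/-- The last digit of a base-`m` numeral. -/
def lowDigit {p : ℕ} (hm : 0 < m) (i : Fin (m ^ (p + 1))) : Fin m :=
  ⟨(i : ℕ) % m, Nat.mod_lt _ hm⟩

/-- A base-`m` numeral with its last digit removed. -/
def dropLow {p : ℕ} (i : Fin (m ^ (p + 1))) : Fin (m ^ p) :=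
  ⟨(i : ℕ) / m, Nat.div_lt_of_lt_mul (by simpa [pow_succ'] using i.2)⟩

/-- Append a last digit to a base-`m` numeral. -/
def appendLow {p : ℕ} (i : Fin (m ^ p)) (d : Fin m) : Fin (m ^ (p + 1)) :=
  ⟨i * m + d, by
    rw [pow_succ]
    calc (i : ℕ) * m + d < i * m + m := by omega
      _ = (i + 1) * m := by ring
      _ ≤ m ^ p * m := Nat.mul_le_mul_right m i.2⟩

theorem lowDigit_appendLow (hm : 0 < m) {p : ℕ} (i : Fin (m ^ p)) (d : Fin m) :
    lowDigit hm (appendLow i d) = d := by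
  ext
  simp [lowDigit, appendLow, Nat.mod_eq_of_lt d.2]

theorem dropLow_appendLow {p : ℕ} (i : Fin (m ^ p)) (d : Fin m) :
    dropLow (appendLow i d) = i := by
  ext
  have hm : 0 < m := d.pos
  simp [dropLow, appendLow, mul_comm _ m, Nat.mul_add_div hm]

theorem topDigit_dropLow_fst {p : ℕ} (i : Fin (m ^ (p + 2))) :
    (topDigit m p (dropLow i)).1 = (topDigit m (p + 1) i).1 := by
  ext
  simp [topDigit_fst_val, dropLow, Nat.div_div_eq_div_mul, pow_succ']

theorem topDigit_dropLow_snd {p : ℕ} (i : Fin (m ^ (p + 2))) :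
    (topDigit m p (dropLow i)).2 = dropLow (topDigit m (p + 1) i).2 := by
  ext
  simp [topDigit_snd_val, dropLow, pow_succ', Nat.mod_mul_right_div_self]

theorem lowDigit_topDigit_snd (hm : 0 < m) {p : ℕ} (i : Fin (m ^ (p + 2))) :
    lowDigit hm (topDigit m (p + 1) i).2 = lowDigit hm i := by
  ext
  simp [topDigit_snd_val, lowDigit, pow_succ']

theorem topDigit_zero_fst (i : Fin (m ^ (0 + 1))) :
    (topDigit m 0 i).1 = Fin.cast (pow_one m) i :=
  Fin.ext (Nat.div_one _)

theorem lowDigit_zero (hm : 0 < m) (i : Fin (m ^ (0 + 1))) :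
    lowDigit hm i = Fin.cast (pow_one m) i :=
  Fin.ext (Nat.mod_eq_of_lt (Fin.cast (pow_one m) i).2)

end Digits

section Star

variable (K : Type) [Field K] {m n : ℕ}

/-- The monomial `x_{d₀1} ⋯ x_{d_{p-1}1}`, where `d₀, …, d_{p-1}` are the digits of the index,
last digit first. -/
noncomputable def xMon (hn : 0 < n) : (p : ℕ) → Fin (m ^ p) → Leavitt K m n
  | 0, _ => 1
  | p + 1, i => xMon hn p (topDigit m p i).2 * xg K (topDigit m p i).1 ⟨0, hn⟩

/-- The monomial `y_{1d_{p-1}} ⋯ y_{1d₀}`, where `d₀, …, d_{p-1}` are the digits of the index,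
last digit first. -/
noncomputable def yMon (hn : 0 < n) : (p : ℕ) → Fin (m ^ p) → Leavitt K m n
  | 0, _ => 1
  | p + 1, i => yg K ⟨0, hn⟩ (topDigit m p i).1 * yMon hn p (topDigit m p i).2

theorem xMon_succ_low (hm : 0 < m) (hn : 0 < n) (p : ℕ) (i : Fin (m ^ (p + 1))) :
    xMon K hn (p + 1) i = xg K (lowDigit hm i) ⟨0, hn⟩ * xMon K hn p (dropLow i) := by
  induction p with
  | zero =>
    simp only [xMon, topDigit_zero_fst, lowDigit_zero, one_mul, mul_one]
  | succ p ih =>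
    rw [xMon, ih, lowDigit_topDigit_snd, ← topDigit_dropLow_fst, ← topDigit_dropLow_snd,
      mul_assoc]
    rfl

theorem yMon_succ_low (hm : 0 < m) (hn : 0 < n) (p : ℕ) (i : Fin (m ^ (p + 1))) :
    yMon K hn (p + 1) i = yMon K hn p (dropLow i) * yg K ⟨0, hn⟩ (lowDigit hm i) := by
  induction p with
  | zero =>
    simp only [yMon, topDigit_zero_fst, lowDigit_zero, one_mul, mul_one]
  | succ p ih =>
    rw [yMon, ih, lowDigit_topDigit_snd, ← topDigit_dropLow_fst, ← topDigit_dropLow_snd,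
      ← mul_assoc]
    rfl

theorem sum_yMon_mul_xMon (hn : 0 < n) (p : ℕ) :
    ∑ i : Fin (m ^ p), yMon K hn p i * xMon K hn p i = 1 := by
  induction p with
  | zero =>
    rw [Fintype.sum_eq_single (⟨0, one_pos⟩ : Fin (m ^ 0))
      fun i hi => absurd (Subsingleton.elim (α := Fin 1) i _) hi]
    simp only [xMon, yMon, one_mul]
  | succ p ih =>
    rw [sum_topDigit]
    have h : ∀ a : Fin m, ∑ s : Fin (m ^ p),
        yMon K hn (p + 1) ((topDigit m p).symm (a, s)) *
          xMon K hn (p + 1) ((topDigit m p).symm (a, s))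
        = yg K ⟨0, hn⟩ a * xg K a ⟨0, hn⟩ := by
      intro a
      simp only [xMon, yMon, Equiv.apply_symm_apply]
      have : ∀ s, yg K ⟨0, hn⟩ a * yMon K hn p s * (xMon K hn p s * xg K a ⟨0, hn⟩) =
          yg K ⟨0, hn⟩ a * (yMon K hn p s * xMon K hn p s) * xg K a ⟨0, hn⟩ := by
        intro s; simp only [mul_assoc]
      simp only [this]
      rw [← Finset.sum_mul, ← Finset.mul_sum, ih, mul_one]
    simp only [h, sum_yg_mul_xg, if_true]

theorem starXY_succ_apply (hm : 0 < m) (hn : 0 < n) (k l : Fin n) (p : ℕ)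
    (i j : Fin (m ^ (p + 2))) :
    starXY K hm hn k l (p + 1) i j = xg K (lowDigit hm i) ⟨0, hn⟩ *
      starXY K hm hn k l p (dropLow i) (dropLow j) * yg K ⟨0, hn⟩ (lowDigit hm j) := by
  rw [starXY, Matrix.mul_apply, Finset.sum_eq_single (dropLow j), Matrix.mul_apply,
    Finset.sum_eq_single (dropLow i)]
  · simp [blockOplus, dropLow, lowDigit]
  · intro s _ hs
    have : ¬ ((i : ℕ) / m = s) := fun h => hs (Fin.ext h.symm)
    simp [blockOplus, this]
  · simp
  · intro s _ hs
    have : ¬ ((s : ℕ) = j / m) := fun h => hs (Fin.ext h)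
    simp [blockOplus, this]
  · simp

theorem starXY_apply (hm : 0 < m) (hn : 0 < n) (k l : Fin n) (p : ℕ)
    (i j : Fin (m ^ (p + 1))) :
    starXY K hm hn k l p i j = xMon K hn p (topDigit m p i).2 * xg K (topDigit m p i).1 k *
      (yg K l (topDigit m p j).1 * yMon K hn p (topDigit m p j).2) := by
  induction p with
  | zero =>
    simp only [starXY, xMon, yMon, topDigit_zero_fst, one_mul, mul_one, Matrix.of_apply]
  | succ p ih =>
    rw [starXY_succ_apply, ih, xMon_succ_low K hm, yMon_succ_low K hm]
    simp only [lowDigit_topDigit_snd, topDigit_dropLow_fst, topDigit_dropLow_snd, mul_assoc]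

theorem starXY_mul (hm : 0 < m) (hn : 0 < n) (k l k' l' : Fin n) (p : ℕ) :
    starXY K hm hn k l p * starXY K hm hn k' l' p =
      if l = k' then starXY K hm hn k l' p else 0 := by
  ext i j
  rw [Matrix.mul_apply, sum_topDigit]
  have h : ∀ a : Fin m, ∑ s : Fin (m ^ p),
      starXY K hm hn k l p i ((topDigit m p).symm (a, s)) *
        starXY K hm hn k' l' p ((topDigit m p).symm (a, s)) j =
      xMon K hn p (topDigit m p i).2 * xg K (topDigit m p i).1 k * (yg K l a * xg K a k') *
        (yg K l' (topDigit m p j).1 * yMon K hn p (topDigit m p j).2) := by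
    intro a
    rw [← mul_one (yg K l a), ← sum_yMon_mul_xMon K hn p]
    simp only [starXY_apply, Equiv.apply_symm_apply, Finset.mul_sum, Finset.sum_mul, mul_assoc]
  simp only [h]
  rw [← Finset.sum_mul, ← Finset.mul_sum, sum_yg_mul_xg]
  split_ifs <;> simp [starXY_apply]

theorem sum_starXY (hm : 0 < m) (hn : 0 < n) (p : ℕ) (i j : Fin (m ^ (p + 1))) :
    ∑ k, starXY K hm hn k k p i j =
      if (topDigit m p i).1 = (topDigit m p j).1 then
        xMon K hn p (topDigit m p i).2 * yMon K hn p (topDigit m p j).2 else 0 := by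
  have h : ∀ k, starXY K hm hn k k p i j = xMon K hn p (topDigit m p i).2 *
      (xg K (topDigit m p i).1 k * yg K k (topDigit m p j).1) *
        yMon K hn p (topDigit m p j).2 := by
    intro k; simp only [starXY_apply, mul_assoc]
  simp only [h]
  rw [← Finset.sum_mul, ← Finset.mul_sum, sum_xg_mul_yg]
  split_ifs <;> simp

/-- The homomorphism `A(m,n) → L(m,n)` sending `e^{p,k,l}` to the `⋆`-product. -/
theorem exists_algHom_starXY (hm : 0 < m) (hn : 0 < n) :
    ∃ φ : AAlg K m n hm hn →ₐ[K] Leavitt K m n,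
      ∀ (p : ℕ) (k l : Fin n) (i j : Fin (m ^ (p + 1))),
        φ (mkA K hm hn (⟨p, k, l, i, j⟩ : AGen m n)) = starXY K hm hn k l p i j := by
  let g : AGen m n → Leavitt K m n := fun a =>
    starXY K hm hn a.2.1 a.2.2.1 a.1 a.2.2.2.1 a.2.2.2.2
  have hg : ∀ p k l i j, FreeAlgebra.lift K g (EmF K m n p k l i j) =
      starXY K hm hn k l p i j := by
    intro p k l i j
    rw [EmF, Matrix.of_apply, FreeAlgebra.lift_ι_apply]
  refine ⟨RingQuot.liftAlgHom K ⟨FreeAlgebra.lift K g, ?_⟩, fun p k l i j => ?_⟩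
  · intro a b h
    cases h with
    | mul p k l k' l' i j =>
      rw [Matrix.mul_apply, map_sum]
      simp only [map_mul, hg]
      rw [← Matrix.mul_apply, starXY_mul]
      split_ifs
      · rw [hg]
      · simp
    | sum0 i j =>
      rw [map_sum]
      simp only [hg]
      rw [sum_starXY]
      have : (topDigit m 0 i).1 = (topDigit m 0 j).1 ↔ i = j := by
        rw [topDigit_zero_fst, topDigit_zero_fst]
        exact (Fin.cast_injective _).eq_iff
      simp only [this, xMon, yMon, mul_one]
      split_ifs <;> simp
    | sumS p i j =>
      rw [map_sum]
      simp only [hg]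
      rw [sum_starXY]
      have : (topDigit m (p + 1) i).1 = (topDigit m (p + 1) j).1 ↔
          (i : ℕ) / m ^ (p + 1) = (j : ℕ) / m ^ (p + 1) := by
        simp [Fin.ext_iff, topDigit_fst_val]
      simp only [this]
      split_ifs
      · rw [hg, starXY_apply]
        rfl
      · simp
  · rw [mkA, RingQuot.liftAlgHom_mkAlgHom_apply, FreeAlgebra.lift_ι_apply]

end Star

section Tower

open Matrix

variable (K : Type) [Field K] {m n : ℕ} (hm : 0 < m) (hn : 0 < n)

theorem eA_apply (p : ℕ) (k l : Fin n) (i j : Fin (m ^ (p + 1))) :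
    eA K hm hn p k l i j = mkA K hm hn ⟨p, k, l, i, j⟩ := rfl

theorem eA_mul (p : ℕ) (k l k' l' : Fin n) :
    eA K hm hn p k l * eA K hm hn p k' l' = if l = k' then eA K hm hn p k l' else 0 := by
  ext i j
  have h := RingQuot.mkAlgHom_rel K (ARel.mul (K := K) (hm := hm) (hn := hn) p k l k' l' i j)
  rw [Matrix.mul_apply, map_sum] at h
  simp only [map_mul] at h
  rw [Matrix.mul_apply]
  refine h.trans ?_
  split_ifs
  · rfl
  · rw [map_zero, Matrix.zero_apply]

/-- The idempotent matrix `e^{p,1,1}` over `A(m,n)`, with `e^{0,1,1} = 1`. -/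
noncomputable def corner : (p : ℕ) → Matrix (Fin (m ^ p)) (Fin (m ^ p)) (AAlg K m n hm hn)
  | 0 => 1
  | p + 1 => eA K hm hn p ⟨0, hn⟩ ⟨0, hn⟩

theorem sum_eA_apply (p : ℕ) (i j : Fin (m ^ (p + 1))) :
    (∑ k, eA K hm hn p k k) i j =
      if (topDigit m p i).1 = (topDigit m p j).1 then
        corner K hm hn p (topDigit m p i).2 (topDigit m p j).2 else 0 := by
  rw [Matrix.sum_apply]
  cases p with
  | zero =>
    have h := RingQuot.mkAlgHom_rel K (ARel.sum0 (K := K) (hm := hm) (hn := hn) i j)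
    rw [map_sum] at h
    refine h.trans ?_
    have h1 : (topDigit m 0 i).1 = (topDigit m 0 j).1 ↔ i = j := by
      rw [topDigit_zero_fst, topDigit_zero_fst]
      exact (Fin.cast_injective _).eq_iff
    have h2 : (topDigit m 0 i).2 = (topDigit m 0 j).2 := Subsingleton.elim (α := Fin 1) _ _
    rw [corner, h2, Matrix.one_apply_eq]
    simp only [h1]
    split_ifs
    · rw [map_one]
    · rw [map_zero]
  | succ p =>
    have h := RingQuot.mkAlgHom_rel K (ARel.sumS (K := K) (hm := hm) (hn := hn) p i j)
    rw [map_sum] at h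
    refine h.trans ?_
    have h1 : (topDigit m (p + 1) i).1 = (topDigit m (p + 1) j).1 ↔
        (i : ℕ) / m ^ (p + 1) = (j : ℕ) / m ^ (p + 1) := by
      simp [Fin.ext_iff, topDigit_fst_val]
    simp only [h1]
    split_ifs
    · rfl
    · rw [map_zero]

theorem sum_eA_mulVec_apply (p : ℕ) (w : Fin (m ^ (p + 1)) → AAlg K m n hm hn)
    (a : Fin m) (s : Fin (m ^ p)) :
    ((∑ k, eA K hm hn p k k) *ᵥ w) ((topDigit m p).symm (a, s)) =
      (corner K hm hn p *ᵥ fun t => w ((topDigit m p).symm (a, t))) s := by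
  simp only [Matrix.mulVec, dotProduct]
  rw [sum_topDigit, Finset.sum_eq_single a]
  · simp only [sum_eA_apply, Equiv.apply_symm_apply, if_true]
  · intro b _ hb
    simp [sum_eA_apply, Ne.symm hb]
  · simp

theorem sum_eA_mul (p : ℕ) (k l : Fin n) :
    (∑ k', eA K hm hn p k' k') * eA K hm hn p k l = eA K hm hn p k l := by
  rw [Finset.sum_mul]
  simp [eA_mul]

theorem mul_sum_eA (p : ℕ) (k l : Fin n) :
    eA K hm hn p k l * (∑ k', eA K hm hn p k' k') = eA K hm hn p k l := by
  rw [Finset.mul_sum]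
  simp [eA_mul]

/-- The space of columns fixed by `e^{p,1,1}`. -/
noncomputable def cornerSpace (p : ℕ) : Submodule K (Fin (m ^ p) → AAlg K m n hm hn) where
  carrier := {v | corner K hm hn p *ᵥ v = v}
  add_mem' := by
    intro v w hv hw
    rw [Set.mem_ofPred_eq] at *
    rw [Matrix.mulVec_add, hv, hw]
  zero_mem' := Matrix.mulVec_zero _
  smul_mem' := by
    intro c v hv
    rw [Set.mem_ofPred_eq] at *
    rw [Matrix.mulVec_smul, hv]

theorem mem_cornerSpace {p : ℕ} {v : Fin (m ^ p) → AAlg K m n hm hn} :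
    v ∈ cornerSpace K hm hn p ↔ corner K hm hn p *ᵥ v = v := Iff.rfl

theorem eA_mulVec_mem (p : ℕ) (l : Fin n) (w : Fin (m ^ (p + 1)) → AAlg K m n hm hn) :
    eA K hm hn p ⟨0, hn⟩ l *ᵥ w ∈ cornerSpace K hm hn (p + 1) := by
  rw [mem_cornerSpace, corner, Matrix.mulVec_mulVec, eA_mul, if_pos rfl]

theorem block_mem (p : ℕ) (w : Fin (m ^ (p + 1)) → AAlg K m n hm hn)
    (hw : (∑ k, eA K hm hn p k k) *ᵥ w = w) (a : Fin m) :
    (fun s => w ((topDigit m p).symm (a, s))) ∈ cornerSpace K hm hn p := by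
  rw [mem_cornerSpace]
  ext s
  rw [← sum_eA_mulVec_apply, hw]

/-- Stacking `m` columns on top of each other. -/
def stack {p : ℕ} (f : Fin m → cornerSpace K hm hn p) :
    Fin (m ^ (p + 1)) → AAlg K m n hm hn :=
  fun r => (f (topDigit m p r).1 : Fin (m ^ p) → AAlg K m n hm hn) (topDigit m p r).2

theorem sum_eA_mulVec_stack {p : ℕ} (f : Fin m → cornerSpace K hm hn p) :
    (∑ k, eA K hm hn p k k) *ᵥ stack K hm hn f = stack K hm hn f := by
  ext r
  obtain ⟨⟨a, s⟩, rfl⟩ := (topDigit m p).symm.surjective r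
  rw [sum_eA_mulVec_apply]
  simp only [stack, Equiv.apply_symm_apply]
  exact congrFun (f a).2 s

/-- The matrix units `e^{p+1,k,l}` identify `m` copies of the column space of `e^{p,1,1}` with
`n` copies of that of `e^{p+1,1,1}`. -/
noncomputable def cornerEquiv (p : ℕ) :
    (Fin m → cornerSpace K hm hn p) ≃ₗ[K] (Fin n → cornerSpace K hm hn (p + 1)) where
  toFun f l := ⟨eA K hm hn p ⟨0, hn⟩ l *ᵥ stack K hm hn f, eA_mulVec_mem K hm hn p l _⟩
  invFun g a := ⟨fun s => (∑ k, eA K hm hn p k ⟨0, hn⟩ *ᵥ (g k).1) ((topDigit m p).symm (a, s)),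
    block_mem K hm hn p _ (by
      rw [Matrix.mulVec_sum]
      simp only [Matrix.mulVec_mulVec, sum_eA_mul]) a⟩
  map_add' f g := by
    ext l : 2
    exact Matrix.mulVec_add _ (stack K hm hn f) (stack K hm hn g)
  map_smul' c f := by
    ext l : 2
    exact Matrix.mulVec_smul _ c (stack K hm hn f)
  left_inv f := by
    ext a s
    simp only [Matrix.mulVec_mulVec, eA_mul, if_true]
    rw [← Matrix.sum_mulVec, sum_eA_mulVec_stack]
    simp [stack]
  right_inv g := by
    ext l : 2
    have : stack K hm hn (fun a => (⟨fun s => (∑ k, eA K hm hn p k ⟨0, hn⟩ *ᵥ (g k).1)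
        ((topDigit m p).symm (a, s)), block_mem K hm hn p _ (by
          rw [Matrix.mulVec_sum]
          simp only [Matrix.mulVec_mulVec, sum_eA_mul]) a⟩ : cornerSpace K hm hn p)) =
        ∑ k, eA K hm hn p k ⟨0, hn⟩ *ᵥ (g k).1 := by
      ext r
      simp only [stack, Prod.mk.eta, Equiv.symm_apply_apply]
    simp only [this]
    rw [Matrix.mulVec_sum]
    simp only [Matrix.mulVec_mulVec, eA_mul]
    rw [Finset.sum_eq_single l]
    · rw [if_pos rfl]
      exact (g l).2
    · intro k _ hk
      rw [if_neg hk.symm, Matrix.zero_mulVec]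
    · simp

theorem cornerEquiv_single (p : ℕ) (l : Fin n) (d : Fin (m ^ (p + 1))) (z : AAlg K m n hm hn)
    (v : cornerSpace K hm hn p)
    (hv : ∀ r, v.1 r = corner K hm hn p r (topDigit m p d).2 * z) (r : Fin (m ^ (p + 1))) :
    (cornerEquiv K hm hn p (Pi.single (topDigit m p d).1 v) l).1 r =
      eA K hm hn p ⟨0, hn⟩ l r d * z := by
  change (eA K hm hn p ⟨0, hn⟩ l *ᵥ stack K hm hn (Pi.single (topDigit m p d).1 v)) r = _
  have h : stack K hm hn (Pi.single (topDigit m p d).1 v) =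
      fun r => (∑ k, eA K hm hn p k k) r d * z := by
    ext r
    rw [sum_eA_apply, stack]
    by_cases hr : (topDigit m p r).1 = (topDigit m p d).1
    · rw [hr, Pi.single_eq_same, hv, if_pos rfl]
    · rw [Pi.single_eq_of_ne hr, if_neg hr, zero_mul]
      rfl
  rw [h, ← mul_sum_eA K hm hn p ⟨0, hn⟩ l]
  conv_rhs => rw [Matrix.mul_apply, Finset.sum_mul]
  rw [mul_sum_eA]
  simp only [Matrix.mulVec, dotProduct, mul_assoc]

theorem cornerEquiv_symm_single (p : ℕ) (k : Fin n) (i : Fin (m ^ (p + 1)))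
    (w : cornerSpace K hm hn (p + 1)) :
    ((cornerEquiv K hm hn p).symm (Pi.single k w) (topDigit m p i).1).1 (topDigit m p i).2 =
      (eA K hm hn p k ⟨0, hn⟩ *ᵥ w.1) i := by
  change (∑ k', eA K hm hn p k' ⟨0, hn⟩ *ᵥ
    ((Pi.single k w : Fin n → cornerSpace K hm hn (p + 1)) k').1)
      ((topDigit m p).symm (topDigit m p i)) = _
  rw [Equiv.symm_apply_apply, Finset.sum_eq_single k]
  · rw [Pi.single_eq_same]
  · intro k' _ hk
    rw [Pi.single_eq_of_ne hk]
    exact Matrix.mulVec_zero _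
  · simp

/-- The element of `A(m,n)`, viewed as a column of height one. -/
noncomputable def cornerZero : AAlg K m n hm hn →ₗ[K] cornerSpace K hm hn 0 where
  toFun z := ⟨fun _ => z, Matrix.one_mulVec _⟩
  map_add' _ _ := rfl
  map_smul' _ _ := rfl

theorem injective_of_map_eq_starXY (φ : AAlg K m n hm hn →ₐ[K] Leavitt K m n)
    (hφ : ∀ (p : ℕ) (k l : Fin n) (i j : Fin (m ^ (p + 1))),
      φ (mkA K hm hn (⟨p, k, l, i, j⟩ : AGen m n)) = starXY K hm hn k l p i j) :
    Function.Injective φ := by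
  obtain ⟨V, _, _, ρ, ι, hι, hy, hx⟩ := exists_leavitt_rep_of_tower hm hn
    (fun p => cornerSpace K hm hn p) (cornerEquiv K hm hn)
  have hY : ∀ (p : ℕ) (d : Fin (m ^ p)) (z : AAlg K m n hm hn),
      ∃ v : cornerSpace K hm hn p, (∀ r, v.1 r = corner K hm hn p r d * z) ∧
        ρ (yMon K hn p d) (ι 0 (cornerZero K hm hn z)) = ι p v := by
    intro p
    induction p with
    | zero =>
      intro d z
      refine ⟨cornerZero K hm hn z, fun r => ?_, ?_⟩
      · rw [show r = d from Subsingleton.elim (α := Fin 1) _ _, corner, Matrix.one_apply_eq,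
          one_mul]
        rfl
      · rw [yMon, map_one, Module.End.one_apply]
    | succ p ih =>
      intro d z
      obtain ⟨v, hv, hv'⟩ := ih (topDigit m p d).2 z
      refine ⟨_, fun r => cornerEquiv_single K hm hn p ⟨0, hn⟩ d z v hv r, ?_⟩
      rw [yMon, map_mul, Module.End.mul_apply, hv', hy]
  have hX : ∀ (p : ℕ) (i : Fin (m ^ p)) (w : cornerSpace K hm hn p),
      ρ (xMon K hn p i) (ι p w) = ι 0 (cornerZero K hm hn (w.1 i)) := by
    intro p
    induction p with
    | zero =>
      intro i w
      rw [xMon, map_one, Module.End.one_apply]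
      congr 1
      ext r
      rw [show r = i from Subsingleton.elim (α := Fin 1) _ _]
      rfl
    | succ p ih =>
      intro i w
      rw [xMon, map_mul, Module.End.mul_apply, hx, ih, cornerEquiv_symm_single]
      congr 3
      exact congrFun w.2 i
  have hgen : ∀ g z, ρ (φ (mkA K hm hn g)) (ι 0 (cornerZero K hm hn z)) =
      ι 0 (cornerZero K hm hn (mkA K hm hn g * z)) := by
    rintro ⟨p, k, l, i, j⟩ z
    obtain ⟨v, hv, hv'⟩ := hY p (topDigit m p j).2 z
    have hw : (cornerEquiv K hm hn p (Pi.single (topDigit m p j).1 v) l).1 =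
        fun r => eA K hm hn p ⟨0, hn⟩ l r j * z :=
      funext fun r => cornerEquiv_single K hm hn p l j z v hv r
    rw [hφ, starXY_apply, map_mul, map_mul, map_mul, Module.End.mul_apply, Module.End.mul_apply,
      Module.End.mul_apply, hv', hy, hx, hX, cornerEquiv_symm_single, hw, ← eA_apply]
    congr 2
    have := eA_mul K hm hn p k ⟨0, hn⟩ ⟨0, hn⟩ l
    rw [if_pos rfl] at this
    rw [← this, Matrix.mul_apply, Finset.sum_mul]
    simp only [Matrix.mulVec, dotProduct, mul_assoc]
  have hmul : ∀ a z, ρ (φ a) (ι 0 (cornerZero K hm hn z)) =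
      ι 0 (cornerZero K hm hn (a * z)) := by
    intro a
    obtain ⟨a, rfl⟩ := RingQuot.mkAlgHom_surjective K (ARel K m n hm hn) a
    induction a using FreeAlgebra.induction with
    | grade0 c =>
      intro z
      simp only [AlgHom.commutes, Module.algebraMap_end_apply, ← Algebra.smul_def, map_smul]
    | grade1 g => exact hgen g
    | mul a b ha hb =>
      intro z
      rw [map_mul, map_mul, map_mul, Module.End.mul_apply, hb, ha, mul_assoc]
    | add a b ha hb =>
      intro z
      rw [map_add, map_add, map_add, LinearMap.add_apply, ha, hb, add_mul, map_add, map_add]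
  intro a b hab
  have h : ι 0 (cornerZero K hm hn (a * 1)) = ι 0 (cornerZero K hm hn (b * 1)) := by
    rw [← hmul, ← hmul, hab]
  have h' : a * 1 = b * 1 := congrFun (congrArg Subtype.val (hι 0 h)) ⟨0, one_pos⟩
  simpa using h'

end Tower

section Range

variable (K : Type) [Field K] {m n : ℕ}

theorem wordToL_append (u v : LWord m n) : wordToL K (u ++ v) = wordToL K u * wordToL K v := by
  simp [wordToL]

theorem wordToL_singleton (z : LGen m n) : wordToL K [z] = lgen K z := by
  simp [wordToL]

theorem exists_word_xMon (hn : 0 < n) (p : ℕ) (i : Fin (m ^ p)) :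
    ∃ w : LWord m n, w.length = p ∧ (∀ z ∈ w, z.isLeft = true) ∧ wordToL K w = xMon K hn p i := by
  induction p with
  | zero => exact ⟨[], rfl, by simp, by simp [wordToL, xMon]⟩
  | succ p ih =>
    obtain ⟨w, hlen, hw, hprod⟩ := ih (topDigit m p i).2
    refine ⟨w ++ [Sum.inl ((topDigit m p i).1, ⟨0, hn⟩)], by simp [hlen], fun z hz => ?_, ?_⟩
    · rcases List.mem_append.1 hz with h | h
      · exact hw z h
      · rw [List.mem_singleton.1 h]; rfl
    · rw [wordToL_append, wordToL_singleton, hprod]; rfl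

theorem exists_word_yMon (hn : 0 < n) (p : ℕ) (i : Fin (m ^ p)) :
    ∃ w : LWord m n, w.length = p ∧ (∀ z ∈ w, z.isRight = true) ∧ wordToL K w = yMon K hn p i := by
  induction p with
  | zero => exact ⟨[], rfl, by simp, by simp [wordToL, yMon]⟩
  | succ p ih =>
    obtain ⟨w, hlen, hw, hprod⟩ := ih (topDigit m p i).2
    refine ⟨[Sum.inr (⟨0, hn⟩, (topDigit m p i).1)] ++ w, by simp [hlen], fun z hz => ?_, ?_⟩
    · rcases List.mem_append.1 hz with h | h
      · rw [List.mem_singleton.1 h]; rfl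
      · exact hw z h
    · rw [wordToL_append, wordToL_singleton, hprod]; rfl

theorem countP_of_forall_isLeft {w : LWord m n} (hw : ∀ z ∈ w, z.isLeft = true) :
    w.countP Sum.isLeft = w.length ∧ w.countP Sum.isRight = 0 := by
  refine ⟨List.countP_eq_length.2 hw, List.countP_eq_zero.2 fun z hz => ?_⟩
  have := hw z hz
  cases z <;> simp_all

theorem countP_of_forall_isRight {w : LWord m n} (hw : ∀ z ∈ w, z.isRight = true) :
    w.countP Sum.isLeft = 0 ∧ w.countP Sum.isRight = w.length := by
  refine ⟨List.countP_eq_zero.2 fun z hz => ?_, List.countP_eq_length.2 hw⟩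
  have := hw z hz
  cases z <;> simp_all

theorem isPrime_append {u v : LWord m n} (hu : ∀ z ∈ u, z.isLeft = true)
    (hv : ∀ z ∈ v, z.isRight = true) (hlen : u.length = v.length) (hne : u ≠ []) :
    LWord.IsPrime (u ++ v) := by
  have hu' := countP_of_forall_isLeft hu
  have hv' := countP_of_forall_isRight hv
  refine ⟨by simp [hne], ?_, fun a b hab ha hb hbal => ?_⟩
  · simp only [LWord.Balanced, List.countP_append]
    omega
  · rw [LWord.Balanced] at hbal
    rcases List.append_eq_append_iff.1 hab with ⟨c, rfl, rfl⟩ | ⟨c, rfl, rfl⟩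
    · have hc := countP_of_forall_isRight fun z hz => hv z (List.mem_append_left b hz)
      have := List.length_pos_iff.2 hb
      simp only [List.countP_append, List.length_append] at *
      omega
    · have hc := countP_of_forall_isLeft fun z hz => hu z (List.mem_append_left c hz)
      have := List.length_pos_iff.2 ha
      omega

theorem starXY_mem_L0xy (hm : 0 < m) (hn : 0 < n) (k l : Fin n) (p : ℕ)
    (i j : Fin (m ^ (p + 1))) : starXY K hm hn k l p i j ∈ L0xy K m n := by
  obtain ⟨u, hulen, hu, huL⟩ := exists_word_xMon K hn p (topDigit m p i).2
  obtain ⟨v, hvlen, hv, hvL⟩ := exists_word_yMon K hn p (topDigit m p j).2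
  set x : LGen m n := Sum.inl ((topDigit m p i).1, k)
  set y : LGen m n := Sum.inr (l, (topDigit m p j).1) with hy
  have hu' : ∀ z ∈ u ++ [x], z.isLeft = true := by
    intro z hz
    rcases List.mem_append.1 hz with h | h
    · exact hu z h
    · rw [List.mem_singleton.1 h]; rfl
  have hv' : ∀ z ∈ [y] ++ v, z.isRight = true := by
    intro z hz
    rcases List.mem_append.1 hz with h | h
    · rw [List.mem_singleton.1 h]; rfl
    · exact hv z h
  have hprime := isPrime_append hu' hv' (by simp [hulen, hvlen]) (by simp)
  refine Algebra.subset_adjoin ⟨(u ++ [x]) ++ ([y] ++ v), hprime, ⟨hprime.2.1, ?_, ?_⟩, ?_⟩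
  · cases u with
    | nil => exact ⟨_, rfl⟩
    | cons z u =>
      obtain ⟨q, rfl⟩ := Sum.isLeft_iff.1 (hu z (by simp))
      exact ⟨q, rfl⟩
  · rcases List.eq_nil_or_concat v with rfl | ⟨v, z, rfl⟩
    · exact ⟨(l, (topDigit m p j).1), by simp [hy]⟩
    · obtain ⟨q, rfl⟩ := Sum.isRight_iff.1 (hv z (by simp))
      exact ⟨q, by rw [List.concat_eq_append, ← List.append_assoc, ← List.append_assoc,
        List.getLast?_concat]⟩
  · rw [wordToL_append, wordToL_append, wordToL_append, wordToL_singleton, wordToL_singleton,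
      huL, hvL, starXY_apply]
    rfl

/-- The subalgebra of `L(m,n)` generated by the entries of the `⋆`-products. -/
noncomputable def starAlg (hm : 0 < m) (hn : 0 < n) : Subalgebra K (Leavitt K m n) :=
  Algebra.adjoin K {a | ∃ p k l i j, starXY K hm hn k l p i j = a}

theorem starXY_mem_starAlg (hm : 0 < m) (hn : 0 < n) (k l : Fin n) (p : ℕ)
    (i j : Fin (m ^ (p + 1))) : starXY K hm hn k l p i j ∈ starAlg K hm hn :=
  Algebra.subset_adjoin ⟨p, k, l, i, j, rfl⟩

theorem xg_mul_yg_mem_starAlg (hm : 0 < m) (hn : 0 < n) (i j : Fin m) (k l : Fin n) :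
    xg K i k * yg K l j ∈ starAlg K hm hn :=
  starXY_mem_starAlg K hm hn k l 0 (Fin.cast (pow_one m).symm i) (Fin.cast (pow_one m).symm j)

theorem xg_mul_mul_yg_mem_starAlg (hm : 0 < m) (hn : 0 < n) {b : Leavitt K m n}
    (hb : b ∈ starAlg K hm hn) (i j : Fin m) :
    xg K i ⟨0, hn⟩ * b * yg K ⟨0, hn⟩ j ∈ starAlg K hm hn := by
  induction hb using Algebra.adjoin_induction generalizing i j with
  | mem b hb =>
    obtain ⟨p, k, l, s, t, rfl⟩ := hb
    have h := starXY_succ_apply K hm hn k l p (appendLow s i) (appendLow t j)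
    rw [lowDigit_appendLow, lowDigit_appendLow, dropLow_appendLow, dropLow_appendLow] at h
    rw [← h]
    exact starXY_mem_starAlg K hm hn _ _ _ _ _
  | algebraMap c =>
    rw [← Algebra.commutes, mul_assoc, ← Algebra.smul_def]
    exact Subalgebra.smul_mem _ (xg_mul_yg_mem_starAlg K hm hn i j _ _) c
  | add b c _ _ ihb ihc =>
    rw [mul_add, add_mul]
    exact add_mem (ihb i j) (ihc i j)
  | mul b c _ _ ihb ihc =>
    have h : xg K i ⟨0, hn⟩ * (b * c) * yg K ⟨0, hn⟩ j =
        ∑ s : Fin m, (xg K i ⟨0, hn⟩ * b * yg K ⟨0, hn⟩ s) *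
          (xg K s ⟨0, hn⟩ * c * yg K ⟨0, hn⟩ j) := by
      have h1 := sum_yg_mul_xg (K := K) (m := m) (⟨0, hn⟩ : Fin n) ⟨0, hn⟩
      rw [if_pos rfl] at h1
      calc _ = xg K i ⟨0, hn⟩ * b * 1 * c * yg K ⟨0, hn⟩ j := by simp only [mul_assoc, one_mul]
        _ = _ := by
          rw [← h1]
          simp only [Finset.mul_sum, Finset.sum_mul, mul_assoc]
    rw [h]
    exact sum_mem fun s _ => mul_mem (ihb i s) (ihc s j)

/-- The elements that are moved into `starAlg` by all right multiplications with `d` letters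
`y_{1i}`. -/
noncomputable def heightSpace (hm : 0 < m) (hn : 0 < n) : ℕ → Submodule K (Leavitt K m n)
  | 0 => Subalgebra.toSubmodule (starAlg K hm hn)
  | d + 1 => ⨅ s : Fin m, (heightSpace hm hn d).comap (LinearMap.mulRight K (yg K ⟨0, hn⟩ s))

theorem mem_heightSpace_succ (hm : 0 < m) (hn : 0 < n) {d : ℕ} {c : Leavitt K m n} :
    c ∈ heightSpace K hm hn (d + 1) ↔ ∀ s, c * yg K ⟨0, hn⟩ s ∈ heightSpace K hm hn d := by
  simp [heightSpace]

theorem mul_yg_eq_sum (hn : 0 < n) (c b : Leavitt K m n) (l : Fin n) (s : Fin m) :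
    c * b * yg K l s =
      ∑ t : Fin m, (c * yg K ⟨0, hn⟩ t) * (xg K t ⟨0, hn⟩ * b * yg K l s) := by
  have h1 := sum_yg_mul_xg (K := K) (m := m) (⟨0, hn⟩ : Fin n) ⟨0, hn⟩
  rw [if_pos rfl] at h1
  calc _ = c * 1 * b * yg K l s := by rw [mul_one]
    _ = _ := by
      rw [← h1]
      simp only [Finset.mul_sum, Finset.sum_mul, mul_assoc]

theorem heightSpace_mul_mem (hm : 0 < m) (hn : 0 < n) {d : ℕ} {c b : Leavitt K m n}
    (hc : c ∈ heightSpace K hm hn d) (hb : b ∈ starAlg K hm hn) :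
    c * b ∈ heightSpace K hm hn d := by
  induction d generalizing c b with
  | zero => exact mul_mem (S := Subalgebra K (Leavitt K m n)) hc hb
  | succ d ih =>
    rw [mem_heightSpace_succ] at hc ⊢
    intro s
    rw [mul_yg_eq_sum K hn]
    exact sum_mem fun t _ => ih (hc t) (xg_mul_mul_yg_mem_starAlg K hm hn hb t s)

theorem mul_xg_mem_heightSpace (hm : 0 < m) (hn : 0 < n) {d : ℕ} {c : Leavitt K m n}
    (hc : c ∈ heightSpace K hm hn d) (i : Fin m) (k : Fin n) :
    c * xg K i k ∈ heightSpace K hm hn (d + 1) := by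
  rw [mem_heightSpace_succ]
  intro s
  rw [mul_assoc]
  exact heightSpace_mul_mem K hm hn hc (xg_mul_yg_mem_starAlg K hm hn _ _ _ _)

theorem mul_yg_mem_heightSpace (hm : 0 < m) (hn : 0 < n) {d : ℕ} {c : Leavitt K m n}
    (hc : c ∈ heightSpace K hm hn (d + 1)) (l : Fin n) (s : Fin m) :
    c * yg K l s ∈ heightSpace K hm hn d := by
  rw [mem_heightSpace_succ] at hc
  rw [← mul_one c, mul_yg_eq_sum K hn]
  refine sum_mem fun t _ => heightSpace_mul_mem K hm hn (hc t) ?_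
  rw [mul_one]
  exact xg_mul_yg_mem_starAlg K hm hn _ _ _ _

theorem wordToL_mem_heightSpace (hm : 0 < m) (hn : 0 < n) (w : LWord m n)
    (hw : ∀ u, u <+: w → u.countP Sum.isRight ≤ u.countP Sum.isLeft) (d : ℕ)
    (hd : w.countP Sum.isLeft = w.countP Sum.isRight + d) :
    wordToL K w ∈ heightSpace K hm hn d := by
  induction w using List.reverseRecOn generalizing d with
  | nil =>
    obtain rfl : d = 0 := by simpa using hd.symm
    exact one_mem (starAlg K hm hn)
  | append_singleton w z ih =>
    have hw' : ∀ u, u <+: w → u.countP Sum.isRight ≤ u.countP Sum.isLeft :=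
      fun u hu => hw u (hu.trans (List.prefix_append w [z]))
    have hle := hw' w (List.prefix_refl w)
    rw [wordToL_append, wordToL_singleton]
    rcases z with ⟨i, k⟩ | ⟨l, s⟩
    · simp only [List.countP_append, List.countP_singleton, Sum.isLeft_inl, Sum.isRight_inl,
        if_true] at hd
      obtain ⟨d, rfl⟩ : ∃ e, d = e + 1 := ⟨d - 1, by simp at hd; omega⟩
      exact mul_xg_mem_heightSpace K hm hn (ih hw' d (by simp at hd; omega)) i k
    · simp only [List.countP_append, List.countP_singleton, Sum.isLeft_inr, Sum.isRight_inr,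
        if_true] at hd
      exact mul_yg_mem_heightSpace K hm hn (ih hw' (d + 1) (by simp at hd; omega)) l s

theorem countP_le_of_prefix {w : LWord m n} (hw : w.IsPrime) (hxy : w.XY) (u : LWord m n)
    (hu : u <+: w) : u.countP Sum.isRight ≤ u.countP Sum.isLeft := by
  induction u using List.reverseRecOn with
  | nil => simp
  | append_singleton u z ih =>
    have hle := ih ((List.prefix_append u [z]).trans hu)
    obtain ⟨v, hv⟩ := hu
    by_cases hu0 : u = []
    · subst hu0
      obtain ⟨-, ⟨q, hq⟩, -⟩ := hxy
      rw [← hv] at hq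
      obtain rfl : z = Sum.inl q := by simpa using hq
      simp
    · have hne : ¬ LWord.Balanced u :=
        hw.2.2 u (z :: v) (by rw [← hv]; simp) hu0 (by simp)
      rw [LWord.Balanced] at hne
      have : List.countP Sum.isRight [z] ≤ 1 := List.countP_le_length
      simp only [List.countP_append]
      omega

theorem starAlg_eq_L0xy (hm : 0 < m) (hn : 0 < n) : starAlg K hm hn = L0xy K m n := by
  apply le_antisymm
  · refine Algebra.adjoin_le ?_
    rintro _ ⟨p, k, l, i, j, rfl⟩
    exact starXY_mem_L0xy K hm hn k l p i j
  · refine Algebra.adjoin_le ?_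
    rintro _ ⟨w, hw, hxy, rfl⟩
    exact wordToL_mem_heightSpace K hm hn w (countP_le_of_prefix hw hxy) 0 hw.2.1

theorem range_eq_starAlg (hm : 0 < m) (hn : 0 < n) (φ : AAlg K m n hm hn →ₐ[K] Leavitt K m n)
    (hφ : ∀ (p : ℕ) (k l : Fin n) (i j : Fin (m ^ (p + 1))),
      φ (mkA K hm hn (⟨p, k, l, i, j⟩ : AGen m n)) = starXY K hm hn k l p i j) :
    φ.range = starAlg K hm hn := by
  apply le_antisymm
  · rintro _ ⟨a, rfl⟩
    obtain ⟨a, rfl⟩ := RingQuot.mkAlgHom_surjective K (ARel K m n hm hn) a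
    induction a using FreeAlgebra.induction with
    | grade0 c =>
      simp
    | grade1 g =>
      obtain ⟨p, k, l, i, j⟩ := g
      have h := starXY_mem_starAlg K hm hn k l p i j
      rw [← hφ] at h
      exact h
    | mul a b ha hb =>
      rw [map_mul]
      exact (map_mul φ _ _).symm ▸ mul_mem ha hb
    | add a b ha hb =>
      rw [map_add]
      exact (map_add φ _ _).symm ▸ add_mem ha hb
  · refine Algebra.adjoin_le ?_
    rintro _ ⟨p, k, l, i, j, rfl⟩
    exact ⟨_, hφ p k l i j⟩

end Range

/-- (Theorem `thmAmnbasis`.) The `K`-algebra homomorphism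
`φ : A(m,n) → L(m,n)` determined entrywise by
`e^{p,k,l} ↦ x_{•1} ⋆ ⋯ ⋆ x_{•1} ⋆ x_{•k} ⋆ y_{l•} ⋆ y_{1•} ⋆ ⋯ ⋆ y_{1•}`
(`p−1` factors `x_{•1}` and `p−1` factors `y_{1•}`; 0-indexed below, so the stored `p`
represents the paper's `p − 1`) is well defined and injective, and its image is
`L(m,n)₀^{xy}`. In particular `A(m,n) ≅ L(m,n)₀^{xy}` as `K`-algebras. -/
theorem stmt16 (K : Type) [Field K] (m n : ℕ) (hm : 0 < m) (hn : 0 < n) :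
    ∃ φ : AAlg K m n hm hn →ₐ[K] Leavitt K m n,
      (∀ (p : ℕ) (k l : Fin n) (i j : Fin (m ^ (p + 1))),
        φ (mkA K hm hn (⟨p, k, l, i, j⟩ : AGen m n)) = starXY K hm hn k l p i j) ∧
      Function.Injective φ ∧ φ.range = L0xy K m n ∧
      Nonempty (AAlg K m n hm hn ≃ₐ[K] L0xy K m n) := by
  obtain ⟨φ, hφ⟩ := exists_algHom_starXY K hm hn
  have hinj := injective_of_map_eq_starXY K hm hn φ hφ
  have hrange : φ.range = L0xy K m n :=
    (range_eq_starAlg K hm hn φ hφ).trans (starAlg_eq_L0xy K hm hn)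
  exact ⟨φ, hφ, hinj, hrange,
    ⟨(AlgEquiv.ofInjective φ hinj).trans (Subalgebra.equivOfEq _ _ hrange)⟩⟩
end

section
/- The zero component L(m,n)_0 is isomorphic to the free product A(m,n) ∗_K A(n,m): there exist K-algebra homomorphisms ι_1 : A(m,n) → L(m,n)_0 and ι_2 : A(n,m) → L(m,n)_0 such that for every unital K-algebra C and every pair of K-algebra homomorphisms f : A(m,n) → C and g : A(n,m) → C there is a unique K-algebra homomorphism h : L(m,n)_0 → C with h∘ι_1 = f and h∘ι_2 = g. -/
open scoped BigOperators

namespace LeavittZero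

open Matrix

/-- Splitting off the leading digit of an index in base `m`. -/
def digit (m p : ℕ) : Fin m × Fin (m ^ p) ≃ Fin (m ^ (p + 1)) :=
  finProdFinEquiv.trans (finCongr (pow_succ' m p).symm)

lemma digit_div {m p : ℕ} (i : Fin m) (a : Fin (m ^ p)) :
    (digit m p (i, a) : ℕ) / m ^ p = i := by
  have h : 0 < m ^ p := a.pos
  simp [digit, finProdFinEquiv, Nat.add_mul_div_left _ _ h]

lemma digit_mod {m p : ℕ} (i : Fin m) (a : Fin (m ^ p)) :
    (digit m p (i, a) : ℕ) % m ^ p = a := by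
  simp [digit, finProdFinEquiv, Nat.mod_eq_of_lt a.isLt]

lemma sum_digit {m p : ℕ} {B : Type} [AddCommMonoid B] (F : Fin (m ^ (p + 1)) → B) :
    ∑ b, F b = ∑ i : Fin m, ∑ a : Fin (m ^ p), F (digit m p (i, a)) := by
  rw [← (digit m p).sum_comp, Fintype.sum_prod_type]

lemma index_zero_eq {m : ℕ} (a b : Fin (m ^ 0)) : a = b := by
  have : Subsingleton (Fin (m ^ 0)) := by rw [pow_zero]; infer_instance
  exact Subsingleton.elim a b

/-- The matrices `e^{p,0,0}`, where `e^{0,0,0}` is the identity. -/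
def topIdem {m n : ℕ} {C : Type} [Ring C] (k₀ : Fin n)
    (e : ∀ p, Fin n → Fin n → Matrix (Fin (m ^ (p + 1))) (Fin (m ^ (p + 1))) C) :
    ∀ p, Matrix (Fin (m ^ p)) (Fin (m ^ p)) C
  | 0 => 1
  | p + 1 => e p k₀ k₀

/-- Families of matrices satisfying the defining relations of `A(m,n)`. -/
structure IsTower {m n : ℕ} {C : Type} [Ring C] (k₀ : Fin n)
    (e : ∀ p, Fin n → Fin n → Matrix (Fin (m ^ (p + 1))) (Fin (m ^ (p + 1))) C) : Prop where
  mul : ∀ p k l k' l', e p k l * e p k' l' = if l = k' then e p k l' else 0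
  sum : ∀ p (i i' : Fin m) (a a' : Fin (m ^ p)),
    ∑ k, e p k k (digit m p (i, a)) (digit m p (i', a')) =
      if i = i' then topIdem k₀ e p a a' else 0

section Presentation

variable {K : Type} [Field K] {m n : ℕ} (hm : 0 < m) (hn : 0 < n) {C : Type} [Ring C] [Algebra K C]

lemma mkA_eq (p : ℕ) (k l : Fin n) (i j : Fin (m ^ (p + 1))) :
    RingQuot.mkAlgHom K (ARel K m n hm hn) (EmF K m n p k l i j) = mkA K hm hn ⟨p, k, l, i, j⟩ :=
  rfl

lemma IsTower.of_algHom (f : AAlg K m n hm hn →ₐ[K] C) :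
    IsTower (m := m) (⟨0, hn⟩ : Fin n)
      (fun p k l => Matrix.of fun i j => f (mkA K hm hn ⟨p, k, l, i, j⟩)) where
  mul p k l k' l' := by
    ext i j
    have h := congrArg f (RingQuot.mkAlgHom_rel K (ARel.mul (hm := hm) (hn := hn) p k l k' l' i j))
    simp only [Matrix.mul_apply, map_sum, map_mul, mkA_eq] at h
    simp only [Matrix.mul_apply, Matrix.of_apply, h]
    split_ifs <;> simp [mkA_eq]
  sum p i i' a a' := by
    cases p with
    | zero =>
      obtain rfl := index_zero_eq a a'
      have h := congrArg f (RingQuot.mkAlgHom_rel K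
        (ARel.sum0 (hm := hm) (hn := hn) (digit m 0 (i, a)) (digit m 0 (i', a))))
      simp only [map_sum, mkA_eq, EmbeddingLike.apply_eq_iff_eq, Prod.mk.injEq, and_true] at h
      simp only [Matrix.of_apply, h]
      split_ifs <;> simp [topIdem]
    | succ p =>
      have h := congrArg f (RingQuot.mkAlgHom_rel K
        (ARel.sumS (hm := hm) (hn := hn) p (digit m (p + 1) (i, a)) (digit m (p + 1) (i', a'))))
      simp only [map_sum, mkA_eq, digit_div, digit_mod, Fin.val_inj] at h
      simp only [Matrix.of_apply, h]
      split_ifs <;> simp [topIdem, mkA_eq]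

/-- The homomorphism out of `A(m,n)` given by a family satisfying its relations. -/
noncomputable def towerLift
    (e : ∀ p, Fin n → Fin n → Matrix (Fin (m ^ (p + 1))) (Fin (m ^ (p + 1))) C)
    (he : IsTower (⟨0, hn⟩ : Fin n) e) : AAlg K m n hm hn →ₐ[K] C :=
  RingQuot.liftAlgHom K
    ⟨FreeAlgebra.lift K fun g : AGen m n => e g.1 g.2.1 g.2.2.1 g.2.2.2.1 g.2.2.2.2, by
      intro u v huv
      induction huv with
      | mul p k l k' l' i j =>
        have h := congrFun (congrFun (he.mul p k l k' l') i) j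
        simp only [Matrix.mul_apply] at h
        simp only [Matrix.mul_apply, map_sum, map_mul, EmF, Matrix.of_apply,
          FreeAlgebra.lift_ι_apply, h]
        split_ifs <;> simp
      | sum0 i j =>
        obtain ⟨⟨i, a⟩, rfl⟩ := (digit m 0).surjective i
        obtain ⟨⟨j, b⟩, rfl⟩ := (digit m 0).surjective j
        obtain rfl := index_zero_eq a b
        simp only [map_sum, EmF, Matrix.of_apply, FreeAlgebra.lift_ι_apply, he.sum,
          EmbeddingLike.apply_eq_iff_eq, Prod.mk.injEq, and_true]
        split_ifs <;> simp [topIdem]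
      | sumS p i j =>
        obtain ⟨⟨i, a⟩, rfl⟩ := (digit m (p + 1)).surjective i
        obtain ⟨⟨j, b⟩, rfl⟩ := (digit m (p + 1)).surjective j
        simp only [map_sum, EmF, Matrix.of_apply, FreeAlgebra.lift_ι_apply, he.sum,
          digit_div, digit_mod, Fin.val_inj]
        split_ifs <;> simp [topIdem]⟩

@[simp] lemma towerLift_mkA
    (e : ∀ p, Fin n → Fin n → Matrix (Fin (m ^ (p + 1))) (Fin (m ^ (p + 1))) C)
    (he : IsTower (⟨0, hn⟩ : Fin n) e) (p : ℕ) (k l : Fin n) (i j : Fin (m ^ (p + 1))) :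
    towerLift (K := K) hm hn e he (mkA K hm hn ⟨p, k, l, i, j⟩) = e p k l i j := by
  simp [towerLift, mkA]

lemma AAlg.induction {P : AAlg K m n hm hn → Prop}
    (hgen : ∀ g, P (mkA K hm hn g)) (hK : ∀ r, P (algebraMap K _ r))
    (hmul : ∀ a b, P a → P b → P (a * b)) (hadd : ∀ a b, P a → P b → P (a + b)) (a) : P a := by
  obtain ⟨a, rfl⟩ := RingQuot.mkAlgHom_surjective K (ARel K m n hm hn) a
  induction a using FreeAlgebra.induction with
  | grade0 r => rw [AlgHom.commutes]; exact hK r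
  | grade1 g => exact hgen g
  | mul a b ha hb => rw [map_mul]; exact hmul _ _ ha hb
  | add a b ha hb => rw [map_add]; exact hadd _ _ ha hb

lemma AAlg.hom_ext {f g : AAlg K m n hm hn →ₐ[K] C}
    (h : ∀ p k l i j, f (mkA K hm hn ⟨p, k, l, i, j⟩) = g (mkA K hm hn ⟨p, k, l, i, j⟩)) :
    f = g := by
  ext ⟨p, k, l, i, j⟩
  exact h p k l i j

end Presentation

section Words

variable {m n : ℕ} {B : Type} [Ring B]

/-- Pairs of mutually inverse matrices, i.e. the defining relations of `L(m,n)`. -/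
structure IsInversePair (x : Fin m → Fin n → B) (y : Fin n → Fin m → B) : Prop where
  xy : ∀ i i', ∑ j, x i j * y j i' = if i = i' then 1 else 0
  yx : ∀ j j', ∑ i, y j i * x i j' = if j = j' then 1 else 0

lemma IsInversePair.symm {x : Fin m → Fin n → B} {y : Fin n → Fin m → B}
    (h : IsInversePair x y) : IsInversePair y x := ⟨h.yx, h.xy⟩

/-- The product `x_{a₁,0} ⋯ x_{a_p,0}` where `a₁, …, a_p` are the digits of `a`. -/
def xs (x : Fin m → Fin n → B) (k₀ : Fin n) : ∀ p, Fin (m ^ p) → B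
  | 0, _ => 1
  | p + 1, a => xs x k₀ p ((digit m p).symm a).2 * x ((digit m p).symm a).1 k₀

/-- The product `y_{0,a_p} ⋯ y_{0,a₁}` where `a₁, …, a_p` are the digits of `a`. -/
def ys (y : Fin n → Fin m → B) (k₀ : Fin n) : ∀ p, Fin (m ^ p) → B
  | 0, _ => 1
  | p + 1, a => y k₀ ((digit m p).symm a).1 * ys y k₀ p ((digit m p).symm a).2

/-- The family of matrices over `B` determined by an inverse pair. -/
def wordTower (x : Fin m → Fin n → B) (y : Fin n → Fin m → B) (k₀ : Fin n) (p : ℕ) (k l : Fin n) :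
    Matrix (Fin (m ^ (p + 1))) (Fin (m ^ (p + 1))) B :=
  Matrix.of fun a b =>
    xs x k₀ p ((digit m p).symm a).2 * x ((digit m p).symm a).1 k *
      (y l ((digit m p).symm b).1 * ys y k₀ p ((digit m p).symm b).2)

variable {x : Fin m → Fin n → B} {y : Fin n → Fin m → B} (k₀ : Fin n)

lemma wordTower_digit (p : ℕ) (k l : Fin n) (i j : Fin m) (a b : Fin (m ^ p)) :
    wordTower x y k₀ p k l (digit m p (i, a)) (digit m p (j, b)) =
      xs x k₀ p a * x i k * (y l j * ys y k₀ p b) := by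
  simp [wordTower]

lemma xs_mul_ys_succ (p : ℕ) (a b : Fin (m ^ (p + 1))) :
    xs x k₀ (p + 1) a * ys y k₀ (p + 1) b = wordTower x y k₀ p k₀ k₀ a b := rfl

lemma IsInversePair.sum_ys_mul_xs (h : IsInversePair x y) (p : ℕ) :
    ∑ a, ys y k₀ p a * xs x k₀ p a = 1 := by
  induction p with
  | zero =>
    rw [Fintype.sum_eq_single ⟨0, by simp⟩ fun a ha => absurd (index_zero_eq _ _) ha]
    simp [xs, ys]
  | succ p ih =>
    have h' := h.yx k₀ k₀
    rw [sum_digit]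
    simp only [xs, ys, Equiv.symm_apply_apply]
    calc _ = ∑ i, y k₀ i * (∑ a, ys y k₀ p a * xs x k₀ p a) * x i k₀ := by
          simp only [Finset.mul_sum, Finset.sum_mul, mul_assoc]
      _ = 1 := by simp [ih, h']

lemma IsInversePair.isTower (h : IsInversePair x y) : IsTower k₀ (wordTower x y k₀) where
  mul p k l k' l' := by
    ext a b
    obtain ⟨⟨i, a⟩, rfl⟩ := (digit m p).surjective a
    obtain ⟨⟨j, b⟩, rfl⟩ := (digit m p).surjective b
    rw [Matrix.mul_apply, sum_digit]
    simp only [wordTower_digit]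
    calc _ = xs x k₀ p a * x i k * (∑ c, y l c * (∑ d, ys y k₀ p d * xs x k₀ p d) * x c k') *
            (y l' j * ys y k₀ p b) := by
          simp only [Finset.mul_sum, Finset.sum_mul, mul_assoc]
      _ = _ := by
          rw [h.sum_ys_mul_xs]
          simp only [mul_one, h.yx]
          split_ifs <;> simp [wordTower_digit]
  sum p i i' a a' := by
    simp only [wordTower_digit]
    calc _ = xs x k₀ p a * (∑ k, x i k * y k i') * ys y k₀ p a' := by
          simp only [Finset.mul_sum, Finset.sum_mul, mul_assoc]
      _ = _ := by
          rw [h.xy]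
          split_ifs
          · cases p with
            | zero => rw [index_zero_eq a a']; simp [xs, ys, topIdem]
            | succ p => rw [mul_one, xs_mul_ys_succ]; rfl
          · simp

end Words

section Ladder

variable {m n : ℕ} {C : Type} [Ring C] (k₀ : Fin n)
  (e : ∀ p, Fin n → Fin n → Matrix (Fin (m ^ (p + 1))) (Fin (m ^ (p + 1))) C)

/-- The action of `x_{ij}` from level `p + 1` to level `p`. -/
def downMat (i : Fin m) (j : Fin n) (p : ℕ) : Matrix (Fin (m ^ p)) (Fin (m ^ (p + 1))) C :=
  Matrix.of fun a b => e p j k₀ (digit m p (i, a)) b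

/-- The action of `y_{ji}` from level `p` to level `p + 1`. -/
def upMat (j : Fin n) (i : Fin m) (p : ℕ) : Matrix (Fin (m ^ (p + 1))) (Fin (m ^ p)) C :=
  Matrix.of fun b a => e p k₀ j b (digit m p (i, a))

variable {k₀ e}

lemma IsTower.sum_down_mul_up (he : IsTower k₀ e) (i i' : Fin m) (p : ℕ) :
    ∑ j, downMat k₀ e i j p * upMat k₀ e j i' p = if i = i' then topIdem k₀ e p else 0 := by
  ext a a'
  have h : ∀ j, (downMat k₀ e i j p * upMat k₀ e j i' p) a a' =
      e p j j (digit m p (i, a)) (digit m p (i', a')) := fun j => by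
    have := congrFun (congrFun (he.mul p j k₀ k₀ j) (digit m p (i, a))) (digit m p (i', a'))
    rw [if_pos rfl] at this
    rw [← this]
    rfl
  rw [Matrix.sum_apply, Finset.sum_congr rfl fun j _ => h j, he.sum]
  split_ifs <;> rfl

lemma IsTower.sum_up_mul_down (he : IsTower k₀ e) (j j' : Fin n) (p : ℕ) :
    ∑ i, upMat k₀ e j i p * downMat k₀ e i j' p = if j = j' then topIdem k₀ e (p + 1) else 0 := by
  have : ∑ i, upMat k₀ e j i p * downMat k₀ e i j' p = e p k₀ j * e p j' k₀ := by
    ext b b'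
    rw [Matrix.sum_apply, Matrix.mul_apply, sum_digit]
    rfl
  rw [this, he.mul]
  rfl

lemma IsTower.up_mul_topIdem (he : IsTower k₀ e) (j : Fin n) (i : Fin m) (p : ℕ) :
    upMat k₀ e j i p * topIdem k₀ e p = upMat k₀ e j i p := by
  ext b a
  have h : e p k₀ j * ∑ k, e p k k = e p k₀ j := by
    simp [Finset.mul_sum, he.mul]
  have hcol := congrFun (congrFun h b) (digit m p (i, a))
  rw [Matrix.mul_apply, sum_digit] at hcol
  simp only [Matrix.sum_apply, he.sum, mul_ite, mul_zero] at hcol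
  rw [Finset.sum_comm] at hcol
  simp only [Finset.sum_ite_eq', Finset.mem_univ, if_true] at hcol
  rw [Matrix.mul_apply]
  exact hcol

/-- An action of an inverse pair on a module with compatible level maps recovers the family of
matrices on the bottom level. -/
lemma IsTower.apply_wordTower (he : IsTower k₀ e) {K B T : Type} [Field K] [Ring B] [Algebra K B]
    [AddCommGroup T] [Module K T] (ρ : B →ₐ[K] Module.End K T)
    {x : Fin m → Fin n → B} {y : Fin n → Fin m → B} (ev : ∀ p, T → Fin (m ^ p) → C)
    (hx : ∀ i j p t, ev p (ρ (x i j) t) = downMat k₀ e i j p *ᵥ ev (p + 1) t)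
    (hy : ∀ j i p t, ev (p + 1) (ρ (y j i) t) = upMat k₀ e j i p *ᵥ ev p t)
    (hE : ∀ p t, topIdem k₀ e p *ᵥ ev p t = ev p t) (t₀ : T) (ht₀ : ∀ a, ev 0 t₀ a = 1)
    (p : ℕ) (k l : Fin n) (a b : Fin (m ^ (p + 1))) (z : Fin (m ^ 0)) :
    ev 0 (ρ (wordTower x y k₀ p k l a b) t₀) z = e p k l a b := by
  have hup : ∀ p l (i : Fin m) (b : Fin (m ^ p)),
      ev p (ρ (ys y k₀ p b) t₀) = (fun c => topIdem k₀ e p c b) →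
      ev (p + 1) (ρ (y l i * ys y k₀ p b) t₀) = fun c => e p k₀ l c (digit m p (i, b)) := by
    intro p l i b h
    rw [map_mul, Module.End.mul_apply, hy, h]
    funext c
    exact congrFun (congrFun (he.up_mul_topIdem l i p) c) b
  have hys : ∀ p (b : Fin (m ^ p)),
      ev p (ρ (ys y k₀ p b) t₀) = fun c => topIdem k₀ e p c b := by
    intro p
    induction p with
    | zero =>
      intro b
      funext c
      rw [index_zero_eq c b]
      simp [ys, topIdem, ht₀]
    | succ p ih =>
      intro b
      obtain ⟨⟨i, b⟩, rfl⟩ := (digit m p).surjective b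
      simp only [ys, Equiv.symm_apply_apply]
      exact hup p k₀ i b (ih b)
  have hxs : ∀ p (a : Fin (m ^ p)) t, ev 0 (ρ (xs x k₀ p a) t) z = ev p t a := by
    intro p
    induction p with
    | zero =>
      intro a t
      simp [xs, index_zero_eq z a]
    | succ p ih =>
      intro a t
      obtain ⟨⟨i, a⟩, rfl⟩ := (digit m p).surjective a
      simp only [xs, Equiv.symm_apply_apply]
      rw [map_mul, Module.End.mul_apply, ih, hx]
      exact congrFun (hE (p + 1) t) _
  obtain ⟨⟨i, a⟩, rfl⟩ := (digit m p).surjective a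
  obtain ⟨⟨j, b⟩, rfl⟩ := (digit m p).surjective b
  rw [wordTower_digit, map_mul, Module.End.mul_apply, map_mul, Module.End.mul_apply, hxs, hx,
    hup p l j b (hys p b)]
  have := congrFun (congrFun (he.mul p k k₀ k₀ l) (digit m p (i, a))) (digit m p (j, b))
  rw [if_pos rfl] at this
  rw [← this]
  rfl

end Ladder

section Action

variable {K : Type} [Field K] {m n : ℕ}

lemma isInversePair_gen : IsInversePair (xg K (m := m) (n := n)) (yg K) where
  xy i i' := by
    have h := RingQuot.mkAlgHom_rel K (LRel.xy (K := K) (n := n) i i')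
    simp only [map_sum, map_mul] at h
    simp only [xg, yg, lgen, h]
    split_ifs <;> simp
  yx j j' := by
    have h := RingQuot.mkAlgHom_rel K (LRel.yx (K := K) (m := m) j j')
    simp only [map_sum, map_mul] at h
    simp only [xg, yg, lgen, h]
    split_ifs <;> simp

lemma exists_algHom_of_isInversePair {B : Type} [Ring B] [Algebra K B] {x : Fin m → Fin n → B}
    {y : Fin n → Fin m → B} (h : IsInversePair x y) :
    ∃ ρ : Leavitt K m n →ₐ[K] B, (∀ i j, ρ (xg K i j) = x i j) ∧ ∀ j i, ρ (yg K j i) = y j i := by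
  refine ⟨RingQuot.liftAlgHom K ⟨FreeAlgebra.lift K
    (Sum.elim (fun q => x q.1 q.2) (fun q => y q.1 q.2)), ?_⟩, ?_, ?_⟩
  · intro u v huv
    induction huv with
    | xy i i' =>
      simp only [map_sum, map_mul, FreeAlgebra.lift_ι_apply, Sum.elim_inl, Sum.elim_inr, h.xy]
      split_ifs <;> simp
    | yx j j' =>
      simp only [map_sum, map_mul, FreeAlgebra.lift_ι_apply, Sum.elim_inl, Sum.elim_inr, h.yx]
      split_ifs <;> simp
  · intro i j
    simp [xg, lgen]
  · intro j i
    simp [yg, lgen]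

/-- Operators that are inverse to each other up to a common operator `E` give an action of the
Leavitt algebra on the fixed space of `E`. -/
lemma exists_action_of_inverse_up_to {V : Type} [AddCommGroup V] [Module K V]
    (X : Fin m → Fin n → Module.End K V) (Y : Fin n → Fin m → Module.End K V) (E : Module.End K V)
    (hxy : ∀ i i', ∑ j, X i j * Y j i' = if i = i' then E else 0)
    (hyx : ∀ j j', ∑ i, Y j i * X i j' = if j = j' then E else 0) :
    ∃ ρ : Leavitt K m n →ₐ[K] Module.End K (LinearMap.eqLocus E LinearMap.id),
      (∀ i j t, (ρ (xg K i j) t : V) = X i j t) ∧ ∀ j i t, (ρ (yg K j i) t : V) = Y j i t := by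
  have hX : ∀ i j, E * X i j = X i j * E := fun i j => by
    have h1 : ∑ i', (∑ j', X i j' * Y j' i') * X i' j = E * X i j := by simp [hxy]
    have h2 : ∑ j', X i j' * (∑ i', Y j' i' * X i' j) = X i j * E := by simp [hyx]
    rw [← h1, ← h2]
    simp only [Finset.mul_sum, Finset.sum_mul, mul_assoc]
    exact Finset.sum_comm
  have hY : ∀ j i, E * Y j i = Y j i * E := fun j i => by
    have h1 : ∑ j', (∑ i', Y j i' * X i' j') * Y j' i = E * Y j i := by simp [hyx]
    have h2 : ∑ i', Y j i' * (∑ j', X i' j' * Y j' i) = Y j i * E := by simp [hxy]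
    rw [← h1, ← h2]
    simp only [Finset.mul_sum, Finset.sum_mul, mul_assoc]
    exact Finset.sum_comm
  have hmem : ∀ Z : Module.End K V, E * Z = Z * E →
      ∀ v ∈ LinearMap.eqLocus E LinearMap.id, Z v ∈ LinearMap.eqLocus E LinearMap.id := by
    intro Z hZ v hv
    have hv' : E v = v := hv
    change E (Z v) = Z v
    rw [← Module.End.mul_apply, hZ, Module.End.mul_apply, hv']
  obtain ⟨ρ, h1, h2⟩ := exists_algHom_of_isInversePair (K := K)
    (x := fun i j => (X i j).restrict (hmem _ (hX i j)))
    (y := fun j i => (Y j i).restrict (hmem _ (hY j i)))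
    { xy := fun i i' => by
        ext t
        have ht : E t = t := t.2
        have h := congrArg (fun Z => Z (t : V)) (hxy i i')
        simp only [LinearMap.sum_apply, Module.End.mul_apply] at h
        simp only [LinearMap.sum_apply, Module.End.mul_apply, AddSubmonoidClass.coe_finsetSum,
          LinearMap.coe_restrict_apply, h]
        split_ifs <;> simp [ht]
      yx := fun j j' => by
        ext t
        have ht : E t = t := t.2
        have h := congrArg (fun Z => Z (t : V)) (hyx j j')
        simp only [LinearMap.sum_apply, Module.End.mul_apply] at h
        simp only [LinearMap.sum_apply, Module.End.mul_apply, AddSubmonoidClass.coe_finsetSum,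
          LinearMap.coe_restrict_apply, h]
        split_ifs <;> simp [ht] }
  exact ⟨ρ, fun i j t => by rw [h1]; rfl, fun j i t => by rw [h2]; rfl⟩

end Action

section Bilateral

variable {m n : ℕ}

/-- Column vectors in all degrees: degree `k` in the first factor, degree `-(k + 1)` in the
second. -/
abbrev Columns (m n : ℕ) (C : Type) : Type :=
  (∀ k, Fin (m ^ k) → C) × (∀ k, Fin (n ^ (k + 1)) → C)

/-- The component of degree `-k`. -/
def negPart {C : Type} : ∀ k, Columns m n C → Fin (n ^ k) → C
  | 0, v => fun _ => v.1 0 ⟨0, by simp⟩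
  | k + 1, v => v.2 k

lemma negPart_zero {C : Type} (v : Columns m n C) (a : Fin (m ^ 0)) (b : Fin (n ^ 0)) :
    negPart 0 v b = v.1 0 a := congrArg (v.1 0) (index_zero_eq _ _)

lemma Columns.ext_of_negPart_succ {C : Type} {v w : Columns m n C} (h : ∀ k, v.1 k = w.1 k)
    (h' : ∀ k, negPart (k + 1) v = negPart (k + 1) w) : v = w :=
  Prod.ext (funext h) (funext h')

lemma Columns.ext_of_fst_succ {C : Type} {v w : Columns m n C} (h : ∀ k, v.1 (k + 1) = w.1 (k + 1))
    (h' : ∀ k, negPart k v = negPart k w) : v = w := by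
  refine ext_of_negPart_succ (fun k => ?_) fun k => h' (k + 1)
  cases k with
  | zero =>
    funext a
    rw [← negPart_zero v a ⟨0, by simp⟩, ← negPart_zero w a ⟨0, by simp⟩, h']
  | succ k => exact h k

variable {K C : Type} [Field K] [Ring C] [Algebra K C]

lemma negPart_add (k : ℕ) (v w : Columns m n C) :
    negPart k (v + w) = negPart k v + negPart k w := by
  cases k <;> rfl

lemma negPart_smul (k : ℕ) (r : K) (v : Columns m n C) :
    negPart k (r • v) = r • negPart k v := by
  cases k <;> rfl

lemma negPart_sum (k : ℕ) {ι : Type} (s : Finset ι) (v : ι → Columns m n C) :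
    negPart k (∑ i ∈ s, v i) = ∑ i ∈ s, negPart k (v i) :=
  map_sum (AddMonoidHom.mk' (negPart k) (negPart_add (m := m) (C := C) k)) v s

variable (K) (k₀ : Fin n) (k₁ : Fin m)
  (e : ∀ p, Fin n → Fin n → Matrix (Fin (m ^ (p + 1))) (Fin (m ^ (p + 1))) C)
  (e' : ∀ p, Fin m → Fin m → Matrix (Fin (n ^ (p + 1))) (Fin (n ^ (p + 1))) C)

/-- The operator of `x_{ij}` on columns. -/
def opX (i : Fin m) (j : Fin n) : Module.End K (Columns m n C) where
  toFun v := (fun k => downMat k₀ e i j k *ᵥ v.1 (k + 1), fun k => upMat k₁ e' i j k *ᵥ negPart k v)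
  map_add' v w := by
    ext <;> simp [negPart_add, mulVec_add]
  map_smul' r v := by
    ext <;> simp [negPart_smul, mulVec_smul]

/-- The operator of `y_{ji}` on columns. -/
def opY (j : Fin n) (i : Fin m) : Module.End K (Columns m n C) where
  toFun v := (fun k => match k with
    | 0 => fun _ => (downMat k₁ e' j i 0 *ᵥ v.2 0) ⟨0, by simp⟩
    | k + 1 => upMat k₀ e j i k *ᵥ v.1 k, fun k => downMat k₁ e' j i (k + 1) *ᵥ v.2 (k + 1))
  map_add' v w := by
    refine Prod.ext (funext fun k => ?_) (funext fun k => ?_)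
    · cases k with
      | zero => exact funext fun _ => congrFun (mulVec_add _ (v.2 0) (w.2 0)) _
      | succ k => exact mulVec_add _ (v.1 k) (w.1 k)
    · simp [mulVec_add]
  map_smul' r v := by
    refine Prod.ext (funext fun k => ?_) (funext fun k => ?_)
    · cases k with
      | zero => exact funext fun _ => congrFun (mulVec_smul _ r (v.2 0)) _
      | succ k => exact mulVec_smul _ r (v.1 k)
    · simp [mulVec_smul]

/-- The operator of the unit on columns. -/
def opE : Module.End K (Columns m n C) where
  toFun v := (fun k => topIdem k₀ e k *ᵥ v.1 k, fun k => topIdem k₁ e' (k + 1) *ᵥ v.2 k)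
  map_add' v w := by
    ext <;> simp [mulVec_add]
  map_smul' r v := by
    ext <;> simp [mulVec_smul]

lemma opX_fst (i : Fin m) (j : Fin n) (v : Columns m n C) (k : ℕ) :
    (opX K k₀ k₁ e e' i j v).1 k = downMat k₀ e i j k *ᵥ v.1 (k + 1) := rfl

lemma negPart_succ_opX (i : Fin m) (j : Fin n) (v : Columns m n C) (k : ℕ) :
    negPart (k + 1) (opX K k₀ k₁ e e' i j v) = upMat k₁ e' i j k *ᵥ negPart k v := rfl

lemma opY_fst_succ (j : Fin n) (i : Fin m) (v : Columns m n C) (k : ℕ) :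
    (opY K k₀ k₁ e e' j i v).1 (k + 1) = upMat k₀ e j i k *ᵥ v.1 k := rfl

lemma negPart_opY (j : Fin n) (i : Fin m) (v : Columns m n C) (k : ℕ) :
    negPart k (opY K k₀ k₁ e e' j i v) = downMat k₁ e' j i k *ᵥ negPart (k + 1) v := by
  cases k with
  | zero => exact funext fun a => congrArg (downMat k₁ e' j i 0 *ᵥ v.2 0) (index_zero_eq _ _)
  | succ k => rfl

lemma opE_fst (v : Columns m n C) (k : ℕ) :
    (opE K k₀ k₁ e e' v).1 k = topIdem k₀ e k *ᵥ v.1 k := rfl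

lemma negPart_opE (v : Columns m n C) (k : ℕ) :
    negPart k (opE K k₀ k₁ e e' v) = topIdem k₁ e' k *ᵥ negPart k v := by
  cases k with
  | zero =>
    simp only [topIdem, one_mulVec]
    exact funext fun _ => congrFun (one_mulVec (v.1 0)) _
  | succ k => rfl

variable {k₀ k₁ e e'}

lemma sum_opX_mul_opY (he : IsTower k₀ e) (he' : IsTower k₁ e') (i i' : Fin m) :
    ∑ j, opX K k₀ k₁ e e' i j * opY K k₀ k₁ e e' j i' =
      if i = i' then opE K k₀ k₁ e e' else 0 := by
  refine LinearMap.ext fun v => Columns.ext_of_negPart_succ (fun k => ?_) fun k => ?_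
  · simp only [LinearMap.sum_apply, Module.End.mul_apply, Prod.fst_sum, Finset.sum_apply, opX_fst,
      opY_fst_succ, mulVec_mulVec, ← sum_mulVec, he.sum_down_mul_up]
    split_ifs
    · rfl
    · exact zero_mulVec _
  · simp only [LinearMap.sum_apply, Module.End.mul_apply, negPart_sum, negPart_succ_opX,
      negPart_opY, mulVec_mulVec, ← sum_mulVec, he'.sum_up_mul_down]
    split_ifs
    · rfl
    · exact zero_mulVec _

lemma sum_opY_mul_opX (he : IsTower k₀ e) (he' : IsTower k₁ e') (j j' : Fin n) :
    ∑ i, opY K k₀ k₁ e e' j i * opX K k₀ k₁ e e' i j' =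
      if j = j' then opE K k₀ k₁ e e' else 0 := by
  refine LinearMap.ext fun v => Columns.ext_of_fst_succ (fun k => ?_) fun k => ?_
  · simp only [LinearMap.sum_apply, Module.End.mul_apply, Prod.fst_sum, Finset.sum_apply, opX_fst,
      opY_fst_succ, mulVec_mulVec, ← sum_mulVec, he.sum_up_mul_down]
    split_ifs
    · rfl
    · exact zero_mulVec _
  · simp only [LinearMap.sum_apply, Module.End.mul_apply, negPart_sum, negPart_succ_opX,
      negPart_opY, mulVec_mulVec, ← sum_mulVec, he'.sum_down_mul_up]
    split_ifs
    · rw [negPart_opE]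
    · rw [zero_mulVec]
      cases k <;> rfl

variable (e' e k₀ k₁) in
/-- The columns on which `opE` is the identity. -/
abbrev StableColumns : Submodule K (Columns m n C) :=
  LinearMap.eqLocus (opE K k₀ k₁ e e') LinearMap.id

/-- In degree `d`, the column `v` is the right multiple of `v'` by `c`. -/
def MultipleAt (d : ℤ) (v v' : Columns m n C) (c : C) : Prop :=
  (∀ p : ℕ, d = p → ∀ a, v.1 p a = v'.1 p a * c) ∧
    ∀ p : ℕ, d = -p → ∀ a, negPart p v a = negPart p v' a * c

lemma mulVec_eq_mul_of_eq_mul {r s : Type} [Fintype s] (M : Matrix r s C) {v v' : s → C} {c : C}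
    (h : ∀ a, v a = v' a * c) (b : r) : (M *ᵥ v) b = (M *ᵥ v') b * c := by
  simp [mulVec, dotProduct, Finset.sum_mul, h, mul_assoc]

lemma MultipleAt.opX {d : ℤ} {v v' : Columns m n C} {c : C} (h : MultipleAt (d + 1) v v' c)
    (i : Fin m) (j : Fin n) :
    MultipleAt d (opX K k₀ k₁ e e' i j v) (opX K k₀ k₁ e e' i j v') c := by
  have h1 : ∀ p : ℕ, d = p → ∀ a, (LeavittZero.opX K k₀ k₁ e e' i j v).1 p a =
      (LeavittZero.opX K k₀ k₁ e e' i j v').1 p a * c := fun p hp a =>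
    mulVec_eq_mul_of_eq_mul _ (h.1 (p + 1) (by push_cast; omega)) a
  refine ⟨h1, fun p hp a => ?_⟩
  cases p with
  | zero =>
    rw [negPart_zero _ ⟨0, by simp⟩, negPart_zero _ ⟨0, by simp⟩]
    exact h1 0 (by simpa using hp) _
  | succ p => exact mulVec_eq_mul_of_eq_mul _ (h.2 p (by push_cast at hp; omega)) a

lemma MultipleAt.opY {d : ℤ} {v v' : Columns m n C} {c : C} (h : MultipleAt (d - 1) v v' c)
    (j : Fin n) (i : Fin m) :
    MultipleAt d (opY K k₀ k₁ e e' j i v) (opY K k₀ k₁ e e' j i v') c := by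
  have h1 : ∀ p : ℕ, d = -p → ∀ a, negPart p (LeavittZero.opY K k₀ k₁ e e' j i v) a =
      negPart p (LeavittZero.opY K k₀ k₁ e e' j i v') a * c := fun p hp a => by
    rw [negPart_opY, negPart_opY]
    exact mulVec_eq_mul_of_eq_mul _ (h.2 (p + 1) (by push_cast; omega)) a
  refine ⟨fun p hp a => ?_, h1⟩
  cases p with
  | zero =>
    rw [← negPart_zero _ a ⟨0, by simp⟩, ← negPart_zero _ a ⟨0, by simp⟩]
    exact h1 0 (by simpa using hp) _
  | succ p => exact mulVec_eq_mul_of_eq_mul _ (h.1 p (by push_cast at hp; omega)) a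

end Bilateral

section Degree

variable {K : Type} [Field K] {m n : ℕ}

lemma degree_append (u w : LWord m n) :
    LWord.degree (u ++ w) = LWord.degree u + LWord.degree w := by
  simp only [LWord.degree, List.countP_append]
  push_cast
  ring

lemma degree_singleton_inl (q : Fin m × Fin n) : LWord.degree ([Sum.inl q] : LWord m n) = 1 := by
  simp [LWord.degree]

lemma degree_singleton_inr (q : Fin n × Fin m) : LWord.degree ([Sum.inr q] : LWord m n) = -1 := by
  simp [LWord.degree]

lemma balanced_iff (w : LWord m n) : w.Balanced ↔ w.degree = 0 := by
  simp only [LWord.Balanced, LWord.degree]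
  omega

variable (K) in
/-- The set of images of words of degree `d`. -/
def monomials (m n : ℕ) (d : ℤ) : Set (Leavitt K m n) :=
  {a | ∃ w : LWord m n, w.degree = d ∧ wordToL K w = a}

lemma one_mem_monomials : (1 : Leavitt K m n) ∈ monomials K m n 0 :=
  ⟨[], by simp [LWord.degree], by simp [wordToL]⟩

lemma mul_mem_monomials {c d : ℤ} {a b : Leavitt K m n} (ha : a ∈ monomials K m n c)
    (hb : b ∈ monomials K m n d) : a * b ∈ monomials K m n (c + d) := by
  obtain ⟨u, rfl, rfl⟩ := ha
  obtain ⟨w, rfl, rfl⟩ := hb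
  exact ⟨u ++ w, degree_append u w, by simp [wordToL]⟩

lemma xg_mem_monomials (i : Fin m) (j : Fin n) : xg K i j ∈ monomials K m n 1 :=
  ⟨_, degree_singleton_inl (i, j), by simp [wordToL, xg]⟩

lemma yg_mem_monomials (j : Fin n) (i : Fin m) : yg K j i ∈ monomials K m n (-1) :=
  ⟨_, degree_singleton_inr (j, i), by simp [wordToL, yg]⟩

lemma monomials_zero_subset : monomials K m n 0 ⊆ L0 K m n := by
  rintro _ ⟨w, hw, rfl⟩
  exact Algebra.subset_adjoin ⟨w, (balanced_iff w).2 hw, rfl⟩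

lemma wordTower_mem_L0 {r s : ℕ} {x : Fin r → Fin s → Leavitt K m n}
    {y : Fin s → Fin r → Leavitt K m n} (ε : ℤ) (hx : ∀ i j, x i j ∈ monomials K m n ε)
    (hy : ∀ j i, y j i ∈ monomials K m n (-ε)) (k₀ : Fin s) (p : ℕ) (k l : Fin s)
    (a b : Fin (r ^ (p + 1))) : wordTower x y k₀ p k l a b ∈ L0 K m n := by
  have hxs : ∀ (p : ℕ) (a : Fin (r ^ p)), xs x k₀ p a ∈ monomials K m n (p * ε) := by
    intro p
    induction p with
    | zero => intro a; simpa [xs] using one_mem_monomials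
    | succ p ih =>
      intro a
      have := mul_mem_monomials (ih ((digit r p).symm a).2) (hx ((digit r p).symm a).1 k₀)
      rwa [show (p : ℤ) * ε + ε = ((p + 1 : ℕ) : ℤ) * ε by push_cast; ring] at this
  have hys : ∀ (p : ℕ) (a : Fin (r ^ p)), ys y k₀ p a ∈ monomials K m n (-(p * ε)) := by
    intro p
    induction p with
    | zero => intro a; simpa [ys] using one_mem_monomials
    | succ p ih =>
      intro a
      have := mul_mem_monomials (hy k₀ ((digit r p).symm a).1) (ih ((digit r p).symm a).2)
      rwa [show -ε + -((p : ℤ) * ε) = -(((p + 1 : ℕ) : ℤ) * ε) by push_cast; ring] at this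
  have := mul_mem_monomials
    (mul_mem_monomials (hxs p ((digit r p).symm a).2) (hx ((digit r p).symm a).1 k))
    (mul_mem_monomials (hy l ((digit r p).symm b).1) (hys p ((digit r p).symm b).2))
  rw [show (p : ℤ) * ε + ε + (-ε + -(p * ε)) = 0 by ring] at this
  exact monomials_zero_subset this

end Degree

section Existence

variable {K C : Type} [Field K] [Ring C] [Algebra K C] {m n : ℕ} {k₀ : Fin n} {k₁ : Fin m}
  {e : ∀ p, Fin n → Fin n → Matrix (Fin (m ^ (p + 1))) (Fin (m ^ (p + 1))) C}
  {e' : ∀ p, Fin m → Fin m → Matrix (Fin (n ^ (p + 1))) (Fin (n ^ (p + 1))) C}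

lemma exists_algHom_of_isTower (he : IsTower k₀ e) (he' : IsTower k₁ e') :
    ∃ h : L0 K m n →ₐ[K] C,
      (∀ p k l a b (z : L0 K m n), (z : Leavitt K m n) = wordTower (xg K) (yg K) k₀ p k l a b →
        h z = e p k l a b) ∧
      ∀ p k l a b (z : L0 K m n), (z : Leavitt K m n) = wordTower (yg K) (xg K) k₁ p k l a b →
        h z = e' p k l a b := by
  obtain ⟨ρ, hρx, hρy⟩ := exists_action_of_inverse_up_to _ _ _
    (sum_opX_mul_opY K he he') (sum_opY_mul_opX K he he')
  have hword : ∀ (w : LWord m n) (d : ℤ) (t t' : StableColumns K k₀ k₁ e e') (c : C),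
      MultipleAt (d + w.degree) (t : Columns m n C) t' c →
      MultipleAt d (ρ (wordToL K w) t : Columns m n C) (ρ (wordToL K w) t') c := by
    intro w
    induction w with
    | nil => intro d t t' c h; simpa [wordToL, LWord.degree] using h
    | cons z w ih =>
      intro d t t' c h
      have hz : wordToL K (z :: w) = lgen K z * wordToL K w := by simp [wordToL]
      have hd : LWord.degree (z :: w) = LWord.degree ([z] : LWord m n) + LWord.degree w :=
        degree_append [z] w
      simp only [hz, map_mul, Module.End.mul_apply]
      rcases z with ⟨i, j⟩ | ⟨j, i⟩
      · rw [hd, degree_singleton_inl, ← add_assoc] at h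
        have := (ih _ t t' c h).opX (K := K) (k₀ := k₀) (k₁ := k₁) (e := e) (e' := e') i j
        rwa [← hρx, ← hρx] at this
      · rw [hd, degree_singleton_inr, ← add_assoc] at h
        have := (ih _ t t' c h).opY (K := K) (k₀ := k₀) (k₁ := k₁) (e := e) (e' := e') j i
        rwa [← hρy, ← hρy] at this
  have hL0 : ∀ z ∈ L0 K m n, ∀ (t t' : StableColumns K k₀ k₁ e e') (c : C),
      MultipleAt 0 (t : Columns m n C) t' c → MultipleAt 0 (ρ z t : Columns m n C) (ρ z t') c := by
    intro z hz
    induction hz using Algebra.adjoin_induction with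
    | mem z hz =>
      obtain ⟨w, hw, rfl⟩ := hz
      intro t t' c h
      exact hword w 0 t t' c (by rwa [(balanced_iff w).1 hw, add_zero])
    | algebraMap r =>
      intro t t' c h
      rw [AlgHom.commutes]
      refine ⟨fun p hp a => ?_, fun p hp a => ?_⟩
      · simp [Module.algebraMap_end_apply, h.1 p hp a]
      · simp [Module.algebraMap_end_apply, negPart_smul, h.2 p hp a]
    | add y z _ _ hy hz =>
      intro t t' c h
      rw [map_add]
      refine ⟨fun p hp a => ?_, fun p hp a => ?_⟩
      · simp [(hy t t' c h).1 p hp a, (hz t t' c h).1 p hp a, add_mul]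
      · simp [negPart_add, (hy t t' c h).2 p hp a, (hz t t' c h).2 p hp a, add_mul]
    | mul y z _ _ hy hz =>
      intro t t' c h
      rw [map_mul]
      exact hy _ _ c (hz t t' c h)
  let bot : Fin (m ^ 0) := ⟨0, by simp⟩
  let bot' : Fin (n ^ 0) := ⟨0, by simp⟩
  let t₀ : StableColumns K k₀ k₁ e e' := ⟨(fun k => match k with
    | 0 => fun _ => 1
    | _ + 1 => 0, 0), by
      refine Columns.ext_of_negPart_succ (fun k => ?_) fun k => ?_
      · cases k with
        | zero => exact one_mulVec _
        | succ k => exact mulVec_zero (topIdem k₀ e (k + 1))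
      · exact mulVec_zero (topIdem k₁ e' (k + 1))⟩
  have ht₀ : ∀ a, (t₀ : Columns m n C).1 0 a = 1 := fun a => rfl
  have hmul : ∀ y ∈ L0 K m n, ∀ t : StableColumns K k₀ k₁ e e', (ρ y t : Columns m n C).1 0 bot =
      (ρ y t₀ : Columns m n C).1 0 bot * (t : Columns m n C).1 0 bot := by
    intro y hy t
    refine (hL0 y hy t t₀ ((t : Columns m n C).1 0 bot) ⟨fun p hp a => ?_, fun p hp a => ?_⟩).1 0
      rfl bot
    · obtain rfl : p = 0 := by omega
      rw [ht₀, one_mul, index_zero_eq a bot]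
    · obtain rfl : p = 0 := by omega
      rw [negPart_zero _ bot, negPart_zero _ bot, ht₀, one_mul]
  let h : L0 K m n →ₐ[K] C := AlgHom.ofLinearMap
    { toFun := fun z => (ρ z t₀ : Columns m n C).1 0 bot
      map_add' := fun y z => by simp only [AddMemClass.coe_add, map_add]; rfl
      map_smul' := fun r z => by simp only [SetLike.val_smul, map_smul]; rfl }
    (by simp [ht₀])
    (fun y z => by
      have := hmul y y.2 (ρ z t₀)
      simpa using this)
  refine ⟨h, fun p k l a b z hz => ?_, fun p k l a b z hz => ?_⟩
  · change (ρ z t₀ : Columns m n C).1 0 bot = _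
    rw [hz]
    exact he.apply_wordTower ρ (fun p t => (t : Columns m n C).1 p)
      (fun i j p t => by rw [hρx, opX_fst]) (fun j i p t => by rw [hρy, opY_fst_succ])
      (fun p t => by rw [← opE_fst K k₀ k₁ e e', show opE K k₀ k₁ e e' t = t from t.2])
      t₀ ht₀ p k l a b bot
  · change (ρ z t₀ : Columns m n C).1 0 bot = _
    rw [hz, ← negPart_zero _ bot bot']
    exact he'.apply_wordTower ρ (fun p t => negPart p (t : Columns m n C))
      (fun i j p t => by rw [hρy, negPart_opY]) (fun j i p t => by rw [hρx, negPart_succ_opX])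
      (fun p t => by rw [← negPart_opE K k₀ k₁ e e', show opE K k₀ k₁ e e' t = t from t.2])
      t₀ (fun a => by rw [negPart_zero _ bot, ht₀]) p k l a b bot'

end Existence

section Generation

variable {K B : Type} [Field K] [Ring B] [Algebra K B] {m n : ℕ}

/-- The products `xs` of degree `d`, where `x` has degree `1` and `y` has degree `-1`. -/
inductive LeftFactor (x : Fin m → Fin n → B) (y : Fin n → Fin m → B) (k₀ : Fin n) (k₁ : Fin m) :
    ℤ → B → Prop
  | pos (p : ℕ) (a : Fin (m ^ p)) : LeftFactor x y k₀ k₁ p (xs x k₀ p a)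
  | neg (p : ℕ) (a : Fin (n ^ p)) : LeftFactor x y k₀ k₁ (-p) (xs y k₁ p a)

/-- The products `ys` of degree `-d`, where `x` has degree `1` and `y` has degree `-1`. -/
inductive RightFactor (x : Fin m → Fin n → B) (y : Fin n → Fin m → B) (k₀ : Fin n) (k₁ : Fin m) :
    ℤ → B → Prop
  | pos (p : ℕ) (a : Fin (m ^ p)) : RightFactor x y k₀ k₁ p (ys y k₀ p a)
  | neg (p : ℕ) (a : Fin (n ^ p)) : RightFactor x y k₀ k₁ (-p) (ys x k₁ p a)

variable {x : Fin m → Fin n → B} {y : Fin n → Fin m → B} {k₀ : Fin n} {k₁ : Fin m}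

lemma LeftFactor.symm {d : ℤ} {v : B} (h : LeftFactor x y k₀ k₁ d v) :
    LeftFactor y x k₁ k₀ (-d) v := by
  cases h with
  | pos p a => exact .neg p a
  | neg p a => rw [neg_neg]; exact .pos p a

lemma RightFactor.symm {d : ℤ} {u : B} (h : RightFactor x y k₀ k₁ d u) :
    RightFactor y x k₁ k₀ (-d) u := by
  cases h with
  | pos p a => exact .neg p a
  | neg p a => rw [neg_neg]; exact .pos p a

lemma IsInversePair.exists_rightFactor_mul_leftFactor (h : IsInversePair x y) (k₀ : Fin n)
    (k₁ : Fin m) (d : ℤ) : ∃ (N : ℕ) (u v : Fin N → B), (∀ a, RightFactor x y k₀ k₁ d (u a)) ∧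
      (∀ a, LeftFactor x y k₀ k₁ d (v a)) ∧ ∑ a, u a * v a = 1 := by
  obtain ⟨p, rfl | rfl⟩ := d.eq_nat_or_neg
  · exact ⟨_, _, _, .pos p, .pos p, h.sum_ys_mul_xs k₀ p⟩
  · exact ⟨_, _, _, .neg p, .neg p, h.symm.sum_ys_mul_xs k₁ p⟩

variable {S : Subalgebra K B}

lemma xs_mul_mul_ys_succ_mem (h : ∀ p k l a b, wordTower x y k₀ p k l a b ∈ S) (i : Fin m)
    (k : Fin n) (p : ℕ) (a : Fin (m ^ p)) (b : Fin (m ^ (p + 1))) :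
    xs x k₀ p a * x i k * ys y k₀ (p + 1) b ∈ S := by
  obtain ⟨⟨j, b⟩, rfl⟩ := (digit m p).surjective b
  have := h p k k₀ (digit m p (i, a)) (digit m p (j, b))
  rw [wordTower_digit] at this
  simpa [ys] using this

lemma xs_succ_mul_mul_ys_mem (h : ∀ p k l a b, wordTower x y k₀ p k l a b ∈ S) (l : Fin n)
    (i : Fin m) (p : ℕ) (a : Fin (m ^ (p + 1))) (b : Fin (m ^ p)) :
    xs x k₀ (p + 1) a * y l i * ys y k₀ p b ∈ S := by
  obtain ⟨⟨j, a⟩, rfl⟩ := (digit m p).surjective a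
  have := h p k₀ l (digit m p (j, a)) (digit m p (i, b))
  rw [wordTower_digit] at this
  simpa [xs, mul_assoc] using this

lemma xs_mul_ys_mem (h : ∀ p k l a b, wordTower x y k₀ p k l a b ∈ S) (p : ℕ)
    (a b : Fin (m ^ p)) : xs x k₀ p a * ys y k₀ p b ∈ S := by
  cases p with
  | zero => simp [xs, ys, one_mem]
  | succ p => exact h p k₀ k₀ a b

lemma LeftFactor.mul_mem (h : ∀ p k l a b, wordTower x y k₀ p k l a b ∈ S)
    (h' : ∀ p k l a b, wordTower y x k₁ p k l a b ∈ S) {d : ℤ} {u v : B}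
    (hv : LeftFactor x y k₀ k₁ d v) (hu : RightFactor x y k₀ k₁ d u) : v * u ∈ S := by
  generalize hd : d = d' at hu
  cases hv with
  | pos p a =>
    cases hu with
    | pos q b =>
      obtain rfl : p = q := by omega
      exact xs_mul_ys_mem h p a b
    | neg q b =>
      obtain rfl : p = 0 := by omega
      obtain rfl : q = 0 := by omega
      simp [xs, ys, one_mem]
  | neg p a =>
    cases hu with
    | pos q b =>
      obtain rfl : p = 0 := by omega
      obtain rfl : q = 0 := by omega
      simp [xs, ys, one_mem]
    | neg q b =>
      obtain rfl : p = q := by omega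
      exact xs_mul_ys_mem h' p a b

lemma LeftFactor.mul_letter_mul_mem (h : ∀ p k l a b, wordTower x y k₀ p k l a b ∈ S)
    (h' : ∀ p k l a b, wordTower y x k₁ p k l a b ∈ S) {d d' : ℤ} {u v : B}
    (hv : LeftFactor x y k₀ k₁ d v) (hu : RightFactor x y k₀ k₁ d' u) (hd : d' = d + 1)
    (i : Fin m) (j : Fin n) : v * x i j * u ∈ S := by
  cases hv with
  | pos p a =>
    cases hu with
    | pos q b =>
      obtain rfl : q = p + 1 := by omega
      exact xs_mul_mul_ys_succ_mem h i j p a b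
    | neg q b => omega
  | neg p a =>
    cases hu with
    | pos q b =>
      obtain ⟨rfl, rfl⟩ | ⟨rfl, rfl⟩ : p = 0 ∧ q = 1 ∨ p = 1 ∧ q = 0 := by omega
      · exact xs_mul_mul_ys_succ_mem h i j 0 ⟨0, by simp⟩ b
      · exact xs_succ_mul_mul_ys_mem h' i j 0 a ⟨0, by simp⟩
    | neg q b =>
      obtain rfl : p = q + 1 := by omega
      exact xs_succ_mul_mul_ys_mem h' i j q a b

lemma wordToL_mem_of_wordTower_mem {S : Subalgebra K (Leavitt K m n)}
    (h : ∀ p k l a b, wordTower (xg K) (yg K) k₀ p k l a b ∈ S)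
    (h' : ∀ p k l a b, wordTower (yg K) (xg K) k₁ p k l a b ∈ S) (w : LWord m n) :
    ∀ {d : ℤ} {u v : Leavitt K m n}, LeftFactor (xg K) (yg K) k₀ k₁ d v →
      RightFactor (xg K) (yg K) k₀ k₁ (d + w.degree) u → v * wordToL K w * u ∈ S := by
  induction w with
  | nil =>
    intro d u v hv hu
    have hu' : RightFactor (xg K) (yg K) k₀ k₁ d u := by simpa [LWord.degree] using hu
    simpa [wordToL] using hv.mul_mem h h' hu'
  | cons z w ih =>
    intro d u v hv hu
    have hd : LWord.degree (z :: w) = LWord.degree ([z] : LWord m n) + LWord.degree w :=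
      degree_append [z] w
    rw [hd, ← add_assoc] at hu
    obtain ⟨N, s, t, hs, ht, hst⟩ :=
      (isInversePair_gen (K := K)).exists_rightFactor_mul_leftFactor k₀ k₁
        (d + LWord.degree ([z] : LWord m n))
    have hz : ∀ a, v * lgen K z * s a ∈ S := by
      intro a
      rcases z with ⟨i, j⟩ | ⟨j, i⟩
      · exact hv.mul_letter_mul_mem h h' (hs a) (by rw [degree_singleton_inl]) i j
      · exact hv.symm.mul_letter_mul_mem h' h (hs a).symm
          (by rw [degree_singleton_inr]; ring) j i
    have key : v * wordToL K (z :: w) * u =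
        ∑ a, v * lgen K z * s a * (t a * wordToL K w * u) := by
      calc v * wordToL K (z :: w) * u
          = v * lgen K z * (∑ a, s a * t a) * (wordToL K w * u) := by
            rw [hst]; simp [wordToL, mul_assoc]
        _ = _ := by simp only [Finset.mul_sum, Finset.sum_mul, mul_assoc]
    rw [key]
    exact sum_mem fun a _ => mul_mem (hz a) (ih (ht a) hu)

lemma L0_le_of_wordTower_mem {S : Subalgebra K (Leavitt K m n)}
    (h : ∀ p k l a b, wordTower (xg K) (yg K) k₀ p k l a b ∈ S)
    (h' : ∀ p k l a b, wordTower (yg K) (xg K) k₁ p k l a b ∈ S) : L0 K m n ≤ S := by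
  refine Algebra.adjoin_le ?_
  rintro _ ⟨w, hw, rfl⟩
  have hu : RightFactor (xg K) (yg K) k₀ k₁ ((0 : ℕ) + w.degree) 1 := by
    rw [(balanced_iff w).1 hw, add_zero]
    exact .pos 0 ⟨0, by simp⟩
  simpa [xs] using wordToL_mem_of_wordTower_mem h h' w (.pos 0 ⟨0, by simp⟩) hu

lemma L0_hom_ext {C : Type} [Ring C] [Algebra K C] {f g : L0 K m n →ₐ[K] C}
    (h : ∀ p k l a b, ∃ z : L0 K m n,
      (z : Leavitt K m n) = wordTower (xg K) (yg K) k₀ p k l a b ∧ f z = g z)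
    (h' : ∀ p k l a b, ∃ z : L0 K m n,
      (z : Leavitt K m n) = wordTower (yg K) (xg K) k₁ p k l a b ∧ f z = g z) : f = g := by
  have hle : L0 K m n ≤ (AlgHom.equalizer f g).map (L0 K m n).val :=
    L0_le_of_wordTower_mem (k₀ := k₀) (k₁ := k₁)
      (fun p k l a b => (h p k l a b).imp fun z hz => ⟨hz.2, hz.1⟩)
      (fun p k l a b => (h' p k l a b).imp fun z hz => ⟨hz.2, hz.1⟩)
  ext z
  obtain ⟨z', hz', hzz'⟩ := hle z.2
  obtain rfl : z' = z := Subtype.ext hzz'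
  exact hz'

end Generation

section Inclusion

variable {K : Type} [Field K] {m n r s : ℕ}

lemma exists_algHom_wordTower (hr : 0 < r) (hs : 0 < s) {x : Fin r → Fin s → Leavitt K m n}
    {y : Fin s → Fin r → Leavitt K m n} (h : IsInversePair x y) (ε : ℤ)
    (hx : ∀ i j, x i j ∈ monomials K m n ε) (hy : ∀ j i, y j i ∈ monomials K m n (-ε)) :
    ∃ ι : AAlg K r s hr hs →ₐ[K] L0 K m n, ∀ p k l a b,
      (ι (mkA K hr hs ⟨p, k, l, a, b⟩) : Leavitt K m n) = wordTower x y ⟨0, hs⟩ p k l a b := by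
  let φ := towerLift (K := K) hr hs _ (h.isTower ⟨0, hs⟩)
  have hφ : ∀ a, φ a ∈ L0 K m n := by
    refine AAlg.induction hr hs (fun ⟨p, k, l, a, b⟩ => ?_) (fun c => ?_)
      (fun a b ha hb => ?_) (fun a b ha hb => ?_)
    · rw [towerLift_mkA]
      exact wordTower_mem_L0 ε hx hy _ p k l a b
    · rw [AlgHom.commutes]
      exact algebraMap_mem _ c
    · rw [map_mul]
      exact mul_mem ha hb
    · rw [map_add]
      exact add_mem ha hb
  exact ⟨φ.codRestrict _ hφ, fun p k l a b => towerLift_mkA hr hs _ _ p k l a b⟩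

end Inclusion

end LeavittZero

/-- (Corollary `cormain`.) `L(m,n)₀ ≅ A(m,n) ∗_K A(n,m)`: there are
`K`-algebra homomorphisms `ι₁ : A(m,n) → L(m,n)₀` and `ι₂ : A(n,m) → L(m,n)₀` such that for
every unital `K`-algebra `C` and homomorphisms `f : A(m,n) → C`, `g : A(n,m) → C` there is a
unique `K`-algebra homomorphism `h : L(m,n)₀ → C` with `h ∘ ι₁ = f` and `h ∘ ι₂ = g`. -/
theorem stmt17 (K : Type) [Field K] (m n : ℕ) (hm : 0 < m) (hn : 0 < n) :
    ∃ (ι₁ : AAlg K m n hm hn →ₐ[K] L0 K m n) (ι₂ : AAlg K n m hn hm →ₐ[K] L0 K m n),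
      ∀ (C : Type) [Ring C] [Algebra K C]
        (f : AAlg K m n hm hn →ₐ[K] C) (g : AAlg K n m hn hm →ₐ[K] C),
        ∃! h : L0 K m n →ₐ[K] C, h.comp ι₁ = f ∧ h.comp ι₂ = g := by
  obtain ⟨ι₁, h₁⟩ := LeavittZero.exists_algHom_wordTower hm hn
    (LeavittZero.isInversePair_gen (K := K)) 1
    LeavittZero.xg_mem_monomials LeavittZero.yg_mem_monomials
  obtain ⟨ι₂, h₂⟩ := LeavittZero.exists_algHom_wordTower hn hm
    (LeavittZero.isInversePair_gen (K := K)).symm (-1)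
    LeavittZero.yg_mem_monomials (by simpa using LeavittZero.xg_mem_monomials)
  refine ⟨ι₁, ι₂, fun C _ _ f g => ?_⟩
  obtain ⟨h, hf, hg⟩ := LeavittZero.exists_algHom_of_isTower (K := K)
    (LeavittZero.IsTower.of_algHom hm hn f) (LeavittZero.IsTower.of_algHom hn hm g)
  refine ⟨h, ⟨?_, ?_⟩, ?_⟩
  · exact LeavittZero.AAlg.hom_ext hm hn fun p k l a b => hf p k l a b _ (h₁ p k l a b)
  · exact LeavittZero.AAlg.hom_ext hn hm fun p k l a b => hg p k l a b _ (h₂ p k l a b)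
  · rintro h' ⟨hf', hg'⟩
    refine LeavittZero.L0_hom_ext (k₀ := ⟨0, hn⟩) (k₁ := ⟨0, hm⟩)
      (fun p k l a b => ⟨_, h₁ p k l a b, ?_⟩) (fun p k l a b => ⟨_, h₂ p k l a b, ?_⟩)
    · rw [hf p k l a b _ (h₁ p k l a b)]
      exact DFunLike.congr_fun hf' _
    · rw [hg p k l a b _ (h₂ p k l a b)]
      exact DFunLike.congr_fun hg' _
end

section
/- The zero component L(m,n)_0 has the Invariant Basis Number property: for all positive integers k and l, if the free right L(m,n)_0-modules (L(m,n)_0)^k and (L(m,n)_0)^l are isomorphic, then k = l. -/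
open scoped BigOperators

namespace LeavittRep

variable (K : Type) [Field K] {m n : ℕ}

/-- Prepend a value to a sequence. -/
def cons {α : Type} (c : α) (a : ℕ → α) : ℕ → α
  | 0 => c
  | k + 1 => a k

/-- Drop the first term of a sequence. -/
def tail {α : Type} (a : ℕ → α) : ℕ → α := fun k => a (k + 1)

theorem cons_tail {α : Type} (a : ℕ → α) : cons (a 0) (tail a) = a := by
  funext k
  cases k <;> rfl

/-- The space of `K`-valued functions of a pair of sequences, on which `L(m,n)` acts. -/
abbrev Space (K : Type) (m n : ℕ) := (ℕ → Fin n) → (ℕ → Fin m) → K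

/-- The action of `x_{ij}`: move a leading `i` of the second sequence to a leading `j` of the
first one. -/
def xOp (i : Fin m) (j : Fin n) : Module.End K (Space K m n) where
  toFun f := fun a b => if a 0 = j then f (tail a) (cons i b) else 0
  map_add' f g := by
    funext a b
    by_cases h : a 0 = j <;> simp [h]
  map_smul' c f := by
    funext a b
    by_cases h : a 0 = j <;> simp [h]

/-- The action of `y_{ji}`, inverse to that of `x_{ij}`. -/
def yOp (j : Fin n) (i : Fin m) : Module.End K (Space K m n) where
  toFun f := fun a b => if b 0 = i then f (cons j a) (tail b) else 0
  map_add' f g := by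
    funext a b
    by_cases h : b 0 = i <;> simp [h]
  map_smul' c f := by
    funext a b
    by_cases h : b 0 = i <;> simp [h]

/-- The action of a generator of `L(m,n)`. -/
def genOp : LGen m n → Module.End K (Space K m n)
  | Sum.inl p => xOp K p.1 p.2
  | Sum.inr q => yOp K q.1 q.2

theorem sum_xOp_mul_yOp (i i' : Fin m) :
    ∑ j : Fin n, xOp K i j * yOp K j i' = if i = i' then 1 else 0 := by
  refine LinearMap.ext fun f => funext fun a => funext fun b => ?_
  have h : ∀ j : Fin n, (xOp K i j * yOp K j i') f a b =
      if a 0 = j then (if i = i' then f (cons j (tail a)) b else 0) else 0 := fun _ => rfl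
  simp only [LinearMap.sum_apply, Finset.sum_apply, h, Finset.sum_ite_eq, Finset.mem_univ,
    if_true, cons_tail]
  split_ifs <;> rfl

theorem sum_yOp_mul_xOp (j j' : Fin n) :
    ∑ i : Fin m, yOp K j i * xOp K i j' = if j = j' then 1 else 0 := by
  refine LinearMap.ext fun f => funext fun a => funext fun b => ?_
  have h : ∀ i : Fin m, (yOp K j i * xOp K i j') f a b =
      if b 0 = i then (if j = j' then f a (cons i (tail b)) else 0) else 0 := fun _ => rfl
  simp only [LinearMap.sum_apply, Finset.sum_apply, h, Finset.sum_ite_eq, Finset.mem_univ,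
    if_true, cons_tail]
  split_ifs <;> rfl

/-- The representation of `L(m,n)` on functions of two sequences. -/
noncomputable def rep : Leavitt K m n →ₐ[K] Module.End K (Space K m n) :=
  RingQuot.liftAlgHom K ⟨FreeAlgebra.lift K (genOp K), by
    intro a b h
    cases h with
    | xy i i' =>
      simp only [map_sum, map_mul, FreeAlgebra.lift_ι_apply, genOp, sum_xOp_mul_yOp]
      split_ifs <;> simp
    | yx j j' =>
      simp only [map_sum, map_mul, FreeAlgebra.lift_ι_apply, genOp, sum_yOp_mul_xOp]
      split_ifs <;> simp⟩

theorem rep_lgen (z : LGen m n) : rep K (lgen K z) = genOp K z := by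
  simp [rep, lgen]

/-- Functions depending only on the first `N` terms of the first sequence and the first `M` terms
of the second one. -/
def window (m n N M : ℕ) : Submodule K (Space K m n) where
  carrier := {f | ∀ a a' b b', (∀ k < N, a k = a' k) → (∀ k < M, b k = b' k) → f a b = f a' b'}
  add_mem' hf hg a a' b b' ha hb := by
    simp only [Pi.add_apply, hf a a' b b' ha hb, hg a a' b b' ha hb]
  zero_mem' _ _ _ _ _ _ := rfl
  smul_mem' c f hf a a' b b' ha hb := by
    simp only [Pi.smul_apply, hf a a' b b' ha hb]

variable {K}

theorem xOp_mem_window {N M : ℕ} {f : Space K m n} (hf : f ∈ window K m n N (M + 1))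
    (i : Fin m) (j : Fin n) : xOp K i j f ∈ window K m n (N + 1) M := by
  intro a a' b b' ha hb
  change (if a 0 = j then f (tail a) (cons i b) else 0) =
    if a' 0 = j then f (tail a') (cons i b') else 0
  rw [ha 0 (by lia), hf (tail a) (tail a') (cons i b) (cons i b') (fun k hk => ha _ (by lia))]
  rintro (_ | k) hk
  · rfl
  · exact hb k (by lia)

theorem yOp_mem_window {N M : ℕ} {f : Space K m n} (hf : f ∈ window K m n (N + 1) M)
    (j : Fin n) (i : Fin m) : yOp K j i f ∈ window K m n N (M + 1) := by
  intro a a' b b' ha hb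
  change (if b 0 = i then f (cons j a) (tail b) else 0) =
    if b' 0 = i then f (cons j a') (tail b') else 0
  rw [hb 0 (by lia), hf (cons j a) (cons j a') (tail b) (tail b') ?_ (fun k hk => hb _ (by lia))]
  rintro (_ | k) hk
  · rfl
  · exact ha k (by lia)

theorem rep_wordToL_mem_window {N M : ℕ} {f : Space K m n} (hf : f ∈ window K m n N M)
    (w : LWord m n) (hN : w.length ≤ N) (hM : w.length ≤ M) (N' M' : ℕ)
    (h₁ : N' + w.countP Sum.isRight = N + w.countP Sum.isLeft)
    (h₂ : M' + w.countP Sum.isLeft = M + w.countP Sum.isRight) :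
    rep K (wordToL K w) f ∈ window K m n N' M' := by
  induction w generalizing N' M' with
  | nil =>
    obtain rfl : N' = N := by simpa using h₁
    obtain rfl : M' = M := by simpa using h₂
    simpa [wordToL] using hf
  | cons z w ih =>
    have hw : rep K (wordToL K (z :: w)) f = genOp K z (rep K (wordToL K w) f) := by
      simp [wordToL, rep_lgen]
    have hl := List.countP_le_length (p := Sum.isLeft) (l := w)
    have hr := List.countP_le_length (p := Sum.isRight) (l := w)
    rw [List.length_cons] at hN hM
    rw [hw]
    rcases z with p | q
    · simp only [List.countP_cons, Sum.isLeft_inl, Sum.isRight_inl, if_true] at h₁ h₂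
      obtain ⟨N₀, rfl⟩ : ∃ N₀, N' = N₀ + 1 := ⟨N' - 1, by simp at h₁; lia⟩
      exact xOp_mem_window (ih (by lia) (by lia) N₀ (M' + 1) (by simp at h₁; lia)
        (by simp at h₂; lia)) _ _
    · simp only [List.countP_cons, Sum.isLeft_inr, Sum.isRight_inr, if_true] at h₁ h₂
      obtain ⟨M₀, rfl⟩ : ∃ M₀, M' = M₀ + 1 := ⟨M' - 1, by simp at h₂; lia⟩
      exact yOp_mem_window (ih (by lia) (by lia) (N' + 1) M₀ (by simp at h₁; lia)
        (by simp at h₂; lia)) _ _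

theorem eventually_rep_mem_window {r : Leavitt K m n} (hr : r ∈ L0 K m n) :
    ∀ᶠ N in Filter.atTop, ∀ f ∈ window K m n N N, rep K r f ∈ window K m n N N := by
  induction hr using Algebra.adjoin_induction with
  | mem r hr =>
    obtain ⟨w, hw, rfl⟩ := hr
    filter_upwards [Filter.eventually_ge_atTop w.length] with N hN f hf
    have hw' : w.countP Sum.isLeft = w.countP Sum.isRight := hw
    exact rep_wordToL_mem_window hf w hN hN N N (by rw [hw']) (by rw [hw'])
  | algebraMap c =>
    filter_upwards with N f hf
    rw [AlgHom.commutes]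
    exact Submodule.smul_mem _ c hf
  | add r s _ _ hr hs =>
    filter_upwards [hr, hs] with N hr hs f hf
    rw [map_add]
    exact Submodule.add_mem _ (hr f hf) (hs f hf)
  | mul r s _ _ hr hs =>
    filter_upwards [hr, hs] with N hr hs f hf
    rw [map_mul]
    exact hr _ (hs f hf)

theorem window_finite (hm : 0 < m) (hn : 0 < n) (N M : ℕ) :
    Module.Finite K (window K m n N M) := by
  let extend {d : ℕ} (hd : 0 < d) (N : ℕ) (p : Fin N → Fin d) : ℕ → Fin d :=
    fun k => if h : k < N then p ⟨k, h⟩ else ⟨0, hd⟩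
  let φ : window K m n N M →ₗ[K] ((Fin N → Fin n) × (Fin M → Fin m) → K) :=
    { toFun := fun f p => f.1 (extend hn N p.1) (extend hm M p.2)
      map_add' := fun _ _ => rfl
      map_smul' := fun _ _ => rfl }
  refine Module.Finite.of_injective φ fun f g hfg => Subtype.ext (funext fun a => funext fun b => ?_)
  have ha : ∀ k < N, a k = extend hn N (fun t => a t) k := fun k hk => by simp [extend, hk]
  have hb : ∀ k < M, b k = extend hm M (fun t => b t) k := fun k hk => by simp [extend, hk]
  rw [f.2 _ _ _ _ ha hb, g.2 _ _ _ _ ha hb]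
  exact congrFun hfg (fun t => a t, fun t => b t)

theorem window_nontrivial (hm : 0 < m) (hn : 0 < n) (N M : ℕ) :
    Nontrivial (window K m n N M) := by
  refine ⟨⟨⟨fun _ _ => 1, fun _ _ _ _ _ _ => rfl⟩, 0, fun h => one_ne_zero (α := K) ?_⟩⟩
  exact congrFun (congrFun (congrArg Subtype.val h) fun _ => ⟨0, hn⟩) fun _ => ⟨0, hm⟩

end LeavittRep

/-- A matrix of endomorphisms that has a left inverse and whose entries preserve a nonzero
finite-dimensional subspace has at least as many rows as columns. -/
theorem card_le_of_left_inverse_of_invariant {K V : Type*} [Field K] [AddCommGroup V] [Module K V]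
    (W : Submodule K V) [Module.Finite K W] [Nontrivial W] {k l : ℕ}
    (A : Matrix (Fin l) (Fin k) (Module.End K V)) (B : Matrix (Fin k) (Fin l) (Module.End K V))
    (hA : ∀ i j, ∀ f ∈ W, A i j f ∈ W) (hBA : B * A = 1) : k ≤ l := by
  let φ : (Fin k → W) →ₗ[K] (Fin l → W) :=
    LinearMap.pi fun i => ∑ j, (A i j).restrict (hA i j) ∘ₗ LinearMap.proj j
  have hφ : ∀ w i, (φ w i : V) = ∑ j, A i j (w j) := fun w i => by simp [φ]
  have hB : ∀ (w : Fin k → W) j, ∑ i, B j i (φ w i) = (w j : V) := fun w j => by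
    have h : ∀ j', ∑ i, B j i (A i j' (w j')) = if j = j' then (w j' : V) else 0 := fun j' => by
      have := congrArg (fun T : Module.End K V => T (w j')) (congrFun (congrFun hBA j) j')
      simp only [Matrix.mul_apply, Matrix.one_apply, LinearMap.sum_apply,
        Module.End.mul_apply] at this
      rw [this]
      split_ifs <;> rfl
    simp_rw [hφ, map_sum]
    rw [Finset.sum_comm]
    simp [h]
  have hinj : Function.Injective φ := fun v w hvw => funext fun j => Subtype.ext <| by
    rw [← hB v j, ← hB w j, hvw]
  have := LinearMap.finrank_le_finrank_of_injective hinj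
  rw [Module.finrank_pi_fintype, Module.finrank_pi_fintype] at this
  simp only [Finset.sum_const, Finset.card_univ, Fintype.card_fin, smul_eq_mul] at this
  exact Nat.le_of_mul_le_mul_right this Module.finrank_pos

theorem apply_eq_sum_mul_of_mulOpposite_linear {R : Type*} [Semiring R] {k l : ℕ}
    (e : (Fin k → R) →ₗ[Rᵐᵒᵖ] (Fin l → R)) (v : Fin k → R) (i : Fin l) :
    e v i = ∑ j, e (Pi.single j 1) i * v j := by
  have hv : v = ∑ j, MulOpposite.op (v j) • (Pi.single j 1 : Fin k → R) := by
    funext t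
    simp [Pi.single_apply]
  conv_lhs => rw [hv]
  simp

theorem exists_matrix_mul_eq_one_of_linearEquiv {R : Type*} [Semiring R] {k l : ℕ}
    (e : (Fin k → R) ≃ₗ[Rᵐᵒᵖ] (Fin l → R)) :
    ∃ (A : Matrix (Fin l) (Fin k) R) (B : Matrix (Fin k) (Fin l) R), B * A = 1 := by
  refine ⟨Matrix.of fun i j => e (Pi.single j 1) i,
    Matrix.of fun j i => e.symm (Pi.single i 1) j, ?_⟩
  ext1 j j'
  have h := apply_eq_sum_mul_of_mulOpposite_linear e.symm.toLinearMap (e (Pi.single j' 1)) j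
  simp only [LinearEquiv.coe_coe, LinearEquiv.symm_apply_apply] at h
  simp only [Matrix.mul_apply, Matrix.of_apply, ← h, Matrix.one_apply, Pi.single_apply]

theorem le_of_L0_linearEquiv {K : Type} [Field K] {m n : ℕ} (hm : 0 < m) (hn : 0 < n) {k l : ℕ}
    (e : (Fin k → L0 K m n) ≃ₗ[(L0 K m n)ᵐᵒᵖ] (Fin l → L0 K m n)) : k ≤ l := by
  obtain ⟨A, B, hBA⟩ := exists_matrix_mul_eq_one_of_linearEquiv e
  have hev : ∀ᶠ N in Filter.atTop, ∀ i j, ∀ f ∈ LeavittRep.window K m n N N,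
      LeavittRep.rep K (A i j : Leavitt K m n) f ∈ LeavittRep.window K m n N N := by
    simp only [Filter.eventually_all]
    exact fun i j => LeavittRep.eventually_rep_mem_window (A i j).2
  obtain ⟨N, hN⟩ := hev.exists
  let ρ := (LeavittRep.rep K).comp (L0 K m n).val
  have := LeavittRep.window_finite (K := K) hm hn N N
  have := LeavittRep.window_nontrivial (K := K) hm hn N N
  refine card_le_of_left_inverse_of_invariant (LeavittRep.window K m n N N) (A.map ρ) (B.map ρ)
    hN ?_
  rw [← Matrix.map_mul, hBA, Matrix.map_one _ (map_zero ρ) (map_one ρ)]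

/-- (Corollary `corIBN`.) The zero component `L(m,n)₀` has the Invariant
Basis Number property: if the free right `L(m,n)₀`-modules `(L(m,n)₀)^k` and `(L(m,n)₀)^l`
are isomorphic for positive integers `k` and `l`, then `k = l`. (Right modules over `R` are
formalized as modules over the opposite ring `Rᵐᵒᵖ`.) -/
theorem stmt19 (K : Type) [Field K] (m n : ℕ) (hm : 0 < m) (hn : 0 < n) :
    ∀ k l : ℕ, 0 < k → 0 < l →
      Nonempty ((Fin k → L0 K m n) ≃ₗ[(L0 K m n)ᵐᵒᵖ] (Fin l → L0 K m n)) → k = l := by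
  rintro k l - - ⟨e⟩
  exact le_antisymm (le_of_L0_linearEquiv hm hn e) (le_of_L0_linearEquiv hm hn e.symm)
end
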